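/- Let p be a prime and let W be a residually algebraic torsion extension of ℤ_{(p)} to ℚ(X), with ramification index e and residue field degree f over ℤ_{(p)}. Then: (a) there exists a pseudo-convergent sequence E ⊂ Q̄_p of transcendental type over ℚ such that W = ℤ_{(p),E}; (b) the following are equivalent: (1) the completion of ℚ(X) with respect to the W-adic topology is a finite extension of ℚ_p; (2) W = ℤ_{(p),α} for some α ∈ Q̄_p transcendental over ℚ; (3) e·f < ∞; and when these hold, the value group of W equals Γ_α and the residue field of W equals k_α; (c) if e·f = ∞, then E may be chosen of transcendental type over ℚ_p, and the extension ℤ_{(p),E} ⊆ ℤ_{p,E} is immediate (same value group and same residue field). -/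

import Mathlib

open Polynomial Filter

noncomputable section

/-- An additive `ℚ`-valued valuation on a field `K` (written additively, with `v 0 = ⊤`). -/
structure AddVal (K : Type) [Field K] where
  v : K → WithTop ℚ
  v_eq_top_iff : ∀ x : K, v x = ⊤ ↔ x = 0
  v_mul : ∀ x y : K, v (x * y) = v x + v y
  min_le_v_add : ∀ x y : K, min (v x) (v y) ≤ v (x + y)

namespace AddVal

variable {K : Type} [Field K] (w : AddVal K)

/-- A Cauchy sequence with respect to an additive valuation. -/
def IsCauchySeq (s : ℕ → K) : Prop :=
  ∀ γ : ℚ, ∃ N : ℕ, ∀ m ≥ N, ∀ n ≥ N, (γ : WithTop ℚ) < w.v (s m - s n)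

/-- Convergence of a sequence to a limit, with respect to an additive valuation. -/
def TendsToVal (s : ℕ → K) (l : K) : Prop :=
  ∀ γ : ℚ, ∃ N : ℕ, ∀ n ≥ N, (γ : WithTop ℚ) < w.v (s n - l)

/-- A pseudo-convergent sequence: `v (s n - s m) < v (s m - s k)` for `n < m < k`. -/
def IsPseudoConvergent (s : ℕ → K) : Prop :=
  ∀ ⦃n m k : ℕ⦄, n < m → m < k → w.v (s n - s m) < w.v (s m - s k)

/-- A sequence is of transcendental type over a subring (mapped in via `g`) if for every
polynomial `f` over that ring the sequence `v (f (s n))` is eventually constant. -/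
def IsTranscendentalTypeOver {R : Type} [CommRing R] (g : R →+* K) (s : ℕ → K) : Prop :=
  ∀ f : Polynomial R, ∃ N : ℕ, ∀ m ≥ N, ∀ n ≥ N,
    w.v (f.eval₂ g (s m)) = w.v (f.eval₂ g (s n))

/-- A sequence of transcendental type: for every polynomial `f ∈ K[X]`, `v (f (s n))` is
eventually constant. -/
def IsTranscendentalType (s : ℕ → K) : Prop :=
  w.IsTranscendentalTypeOver (RingHom.id K) s

/-- `α` is a pseudo-limit of `s` when `v (s n - α)` is strictly increasing. -/
def IsPseudoLimit (s : ℕ → K) (α : K) : Prop :=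
  StrictMono fun n => w.v (s n - α)

/-- The breadth ideal of a pseudo-convergent sequence. -/
def breadth (s : ℕ → K) : Set K :=
  {x : K | ∀ n : ℕ, w.v (s (n + 1) - s n) < w.v x}

/-- Equivalence of pseudo-convergent sequences. -/
def SeqEquiv (s t : ℕ → K) : Prop :=
  w.breadth s = w.breadth t ∧
    ∀ k : ℕ, ∃ i₀ j₀ : ℕ, ∀ i ≥ i₀, ∀ j ≥ j₀, w.v (s (k + 1) - s k) < w.v (s i - t j)

end AddVal

/-- `α` is transcendental over the image of `g`. -/
def IsTranscOver {R K : Type} [CommRing R] [Field K] (g : R →+* K) (α : K) : Prop :=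
  ∀ f : Polynomial R, f ≠ 0 → f.eval₂ g α ≠ 0
/-- A fixed algebraic closure of `ℚ_p`. -/
abbrev Qpbar (p : ℕ) [Fact p.Prime] : Type := AlgebraicClosure ℚ_[p]

/-- The unique extension of the `p`-adic valuation to the algebraic closure of `ℚ_p`,
presented as an additive `ℚ`-valued valuation extending `Padic.valuation`. -/
structure PadicSetup (p : ℕ) [Fact p.Prime] where
  vbar : AddVal (Qpbar p)
  vbar_extends : ∀ x : ℚ_[p], x ≠ 0 →
    vbar.v (algebraMap ℚ_[p] (Qpbar p) x) = ((x.valuation : ℚ) : WithTop ℚ)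

/-- A model of `ℂ_p`: a complete valued field in which `Q̄_p` embeds isometrically
and densely. -/
structure CpSetup (p : ℕ) [Fact p.Prime] extends PadicSetup p where
  Cp : Type
  [fieldCp : Field Cp]
  emb : Qpbar p →+* Cp
  vC : AddVal Cp
  vC_emb : ∀ x : Qpbar p, vC.v (emb x) = vbar.v x
  complete : ∀ s : ℕ → Cp, vC.IsCauchySeq s → ∃ l : Cp, vC.TendsToVal s l
  dense : ∀ y : Cp, ∃ s : ℕ → Qpbar p, vC.TendsToVal (fun n => emb (s n)) y

attribute [instance] CpSetup.fieldCp

variable (p : ℕ) [Fact p.Prime]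

/-- The degree `[ℚ_p(x) : ℚ_p]` of an element of the algebraic closure of `ℚ_p`. -/
def degOf (x : Qpbar p) : ℕ :=
  Module.finrank ℚ_[p] ↥(IntermediateField.adjoin ℚ_[p] {x})

/-- A stacked sequence in `Q̄_p`: `s 0 ∈ ℚ_p`, the degrees `[ℚ_p(s n) : ℚ_p]` are strictly
increasing, and each `(s n, v (s (n+1) - s n))` is a minimal pair. -/
structure IsStacked (S : PadicSetup p) (s : ℕ → Qpbar p) : Prop where
  first : ∃ c : ℚ_[p], s 0 = algebraMap ℚ_[p] (Qpbar p) c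
  deg_lt : ∀ n : ℕ, degOf p (s n) < degOf p (s (n + 1))
  min_pair : ∀ n : ℕ, ∀ c : Qpbar p, degOf p c < degOf p (s n) →
    S.vbar.v (s n - c) < S.vbar.v (s (n + 1) - s n)

/-- A strongly stacked sequence: moreover each pair `(s n, s (n+1))` is distinguished. -/
structure IsStronglyStacked (S : PadicSetup p) (s : ℕ → Qpbar p) extends
    IsStacked p S s : Prop where
  dist : ∀ n : ℕ, ∀ c : Qpbar p, degOf p c < degOf p (s (n + 1)) →
    S.vbar.v (s (n + 1) - c) ≤ S.vbar.v (s (n + 1) - s n)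

/-- The canonical map `ℚ → Q̄_p`. -/
def qHomQpbar : ℚ →+* Qpbar p :=
  (algebraMap ℚ_[p] (Qpbar p)).comp (Rat.castHom ℚ_[p])

/-- The ring `ℤ_{p,E}` (as a subset of `ℚ_p(X)`) attached to a sequence `E ⊆ Q̄_p`:
rational functions mapping almost all the `s n` into `Z̄_p`. -/
def ZpE (S : PadicSetup p) (s : ℕ → Qpbar p) : Set (RatFunc ℚ_[p]) :=
  {φ : RatFunc ℚ_[p] | ∀ᶠ n in atTop,
    φ.denom.eval₂ (algebraMap ℚ_[p] (Qpbar p)) (s n) ≠ 0 ∧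
      0 ≤ S.vbar.v (φ.eval (algebraMap ℚ_[p] (Qpbar p)) (s n))}

/-- The ring `ℤ_{(p),E}` (as a subset of `ℚ(X)`) attached to a sequence `E ⊆ Q̄_p`. -/
def ZplE (S : PadicSetup p) (s : ℕ → Qpbar p) : Set (RatFunc ℚ) :=
  {φ : RatFunc ℚ | ∀ᶠ n in atTop,
    φ.denom.eval₂ (qHomQpbar p) (s n) ≠ 0 ∧
      0 ≤ S.vbar.v (φ.eval (qHomQpbar p) (s n))}

/-- `W` is a residually algebraic torsion extension of `ℤ_p` to `ℚ_p(X)`: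
`W ∩ ℚ_p = ℤ_p`, the residue field of `W` is algebraic over `𝔽_p`, and the value group of `W`
is contained in the divisible hull of the value group of `ℤ_p`. -/
def IsResAlgTorsionQp (W : ValuationSubring (RatFunc ℚ_[p])) : Prop :=
  (∀ c : ℚ_[p], RatFunc.C c ∈ W ↔ ‖c‖ ≤ 1) ∧
  (∀ x : IsLocalRing.ResidueField W, ∃ k : ℕ, 1 ≤ k ∧ x ^ p ^ k = x) ∧
  (∀ φ : RatFunc ℚ_[p], φ ≠ 0 → ∃ n : ℕ, 1 ≤ n ∧ ∃ c : ℚ_[p], c ≠ 0 ∧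
    φ ^ n / RatFunc.C c ∈ W ∧ RatFunc.C c / φ ^ n ∈ W)

/-- `W` is a residually algebraic torsion extension of `ℤ_(p)` to `ℚ(X)`. -/
def IsResAlgTorsionQ (W : ValuationSubring (RatFunc ℚ)) : Prop :=
  (∀ c : ℚ, RatFunc.C c ∈ W ↔ ‖(c : ℚ_[p])‖ ≤ 1) ∧
  (∀ x : IsLocalRing.ResidueField W, ∃ k : ℕ, 1 ≤ k ∧ x ^ p ^ k = x) ∧
  (∀ φ : RatFunc ℚ, φ ≠ 0 → ∃ n : ℕ, 1 ≤ n ∧ ∃ c : ℚ, c ≠ 0 ∧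
    φ ^ n / RatFunc.C c ∈ W ∧ RatFunc.C c / φ ^ n ∈ W)

/-- The set of (rational) values of the valuation on an intermediate field of `Q̄_p/ℚ_p`. -/
def valSetF (S : PadicSetup p) (F : IntermediateField ℚ_[p] (Qpbar p)) : Set ℚ :=
  {γ : ℚ | ∃ a ∈ F, S.vbar.v a = (γ : WithTop ℚ)}

/-- The value group (as a set of rationals) of `ℚ_p(x)` for `x ∈ Q̄_p`. -/
def valSetElem (S : PadicSetup p) (x : Qpbar p) : Set ℚ :=
  valSetF p S (IntermediateField.adjoin ℚ_[p] {x})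

/-- The residue field of `F` is contained in the residue field of `F'` (inside the residue
field of `Z̄_p`). -/
def resSub (S : PadicSetup p) (F F' : IntermediateField ℚ_[p] (Qpbar p)) : Prop :=
  ∀ a ∈ F, 0 ≤ S.vbar.v a → ∃ b ∈ F', 0 ≤ S.vbar.v b ∧ 0 < S.vbar.v (a - b)

/-- A subset `Γ ⊆ ℚ` (a value group) has bounded denominators, i.e. finite ramification
over `ℤ`. -/
def HasFiniteRamification (Γ : Set ℚ) : Prop :=
  ∃ e : ℕ, 0 < e ∧ ∀ γ ∈ Γ, ∃ k : ℤ, (e : ℚ) * γ = (k : ℚ)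

/-- The ramification index of `Γ₁` over `Γ₀`: the least positive integer `e` with
`e • Γ₁ ⊆ Γ₀` (for the value groups of finite extensions of `ℚ_p` this is the index
`[Γ₁ : Γ₀]`). -/
def ramIdx (Γ₀ Γ₁ : Set ℚ) : ℕ :=
  sInf {e : ℕ | 0 < e ∧ ∀ γ ∈ Γ₁, (e : ℚ) * γ ∈ Γ₀}

/-- The value group of `ℚ_p` (normalized): the integers, as a subset of `ℚ`. -/
def zSet : Set ℚ := Set.range ((↑) : ℤ → ℚ)

/-- The maximal unramified extension of a finite extension `K` of `ℚ_p` inside `Q̄_p`: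
the set of `x` with `K(x)/K` unramified. -/
def maxUnramified (S : PadicSetup p) (K : IntermediateField ℚ_[p] (Qpbar p)) :
    Set (Qpbar p) :=
  {x : Qpbar p | valSetF p S (K ⊔ IntermediateField.adjoin ℚ_[p] {x}) = valSetF p S K}

section CpDefs

variable (S : CpSetup p)

/-- The canonical map `ℚ_p → ℂ_p`. -/
def qpHomC : ℚ_[p] →+* S.Cp :=
  S.emb.comp (algebraMap ℚ_[p] (Qpbar p))

/-- The canonical map `ℚ → ℂ_p`. -/
def qHomC : ℚ →+* S.Cp :=
  (qpHomC p S).comp (Rat.castHom ℚ_[p])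

/-- The valuation domain `ℤ_{p,α} = {φ ∈ ℚ_p(X) : φ(α) ∈ O_p}` (as a subset of `ℚ_p(X)`). -/
def Zpa (α : S.Cp) : Set (RatFunc ℚ_[p]) :=
  {φ : RatFunc ℚ_[p] | φ.denom.eval₂ (qpHomC p S) α ≠ 0 ∧
    0 ≤ S.vC.v (φ.eval (qpHomC p S) α)}

/-- The valuation domain `ℤ_{(p),α} = {φ ∈ ℚ(X) : φ(α) ∈ O_p}` (as a subset of `ℚ(X)`). -/
def Zpla (α : S.Cp) : Set (RatFunc ℚ) :=
  {φ : RatFunc ℚ | φ.denom.eval₂ (qHomC p S) α ≠ 0 ∧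
    0 ≤ S.vC.v (φ.eval (qHomC p S) α)}

/-- Membership in the subfield `ℚ_p(α)` of `ℂ_p`. -/
def InQpAlpha (α x : S.Cp) : Prop :=
  ∃ f g : Polynomial ℚ_[p], g.eval₂ (qpHomC p S) α ≠ 0 ∧
    x = f.eval₂ (qpHomC p S) α / g.eval₂ (qpHomC p S) α

/-- The value group `Γ_α ⊆ ℚ` of `ℚ_p(α) ⊆ ℂ_p`. -/
def valSetCp (α : S.Cp) : Set ℚ :=
  {γ : ℚ | ∃ x : S.Cp, InQpAlpha p S α x ∧ S.vC.v x = (γ : WithTop ℚ)}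

/-- The residue field `k_α` of `O_{p,α} = O_p ∩ ℚ_p(α)` is finite. -/
def ResFieldFiniteCp (α : S.Cp) : Prop :=
  ∃ T : Finset S.Cp, ∀ x : S.Cp, InQpAlpha p S α x → 0 ≤ S.vC.v x →
    ∃ a ∈ T, 0 < S.vC.v (x - a)

/-- `α` and `β` are conjugate over `ℚ_p`: some element of `Gal(Q̄_p/ℚ_p)`, extended to its
unique continuous (equivalently, isometric) automorphism of `ℂ_p`, maps `α` to `β`. -/
def ConjCp (α β : S.Cp) : Prop :=
  ∃ σ : S.Cp →+* S.Cp, (∀ c : ℚ_[p], σ (qpHomC p S c) = qpHomC p S c) ∧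
    (∀ x : Qpbar p, ∃ y : Qpbar p, σ (S.emb x) = S.emb y) ∧
    (∀ x : S.Cp, S.vC.v (σ x) = S.vC.v x) ∧ σ α = β

end CpDefs



/-- The valuation domain `ℤ_{(p),α} = {φ ∈ ℚ(X) : φ(α) ∈ Z̄_p}` for `α ∈ Q̄_p`. -/
def ZplaBar (p : ℕ) [Fact p.Prime] (S : PadicSetup p) (α : Qpbar p) : Set (RatFunc ℚ) :=
  {φ : RatFunc ℚ | φ.denom.eval₂ (qHomQpbar p) α ≠ 0 ∧
    0 ≤ S.vbar.v (φ.eval (qHomQpbar p) α)}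

section

variable {p}

/-! ### The norm attached to an additive valuation -/

/-- The real absolute value `p ^ (-γ)` attached to a value `γ`, with value `0` at `⊤`. -/
def absOfVal (p : ℕ) (γ : WithTop ℚ) : ℝ :=
  WithTop.recTopCoe 0 (fun q : ℚ => (p : ℝ) ^ (-(q : ℝ))) γ

@[simp]
theorem absOfVal_top {p : ℕ} : absOfVal p ⊤ = 0 := rfl

theorem absOfVal_coe {p : ℕ} (q : ℚ) : absOfVal p (q : WithTop ℚ) = (p : ℝ) ^ (-(q : ℝ)) := rfl

theorem one_lt_cast_prime : (1 : ℝ) < p := by exact_mod_cast (Fact.out : p.Prime).one_lt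

theorem cast_prime_pos : (0 : ℝ) < p := by exact_mod_cast (Fact.out : p.Prime).pos

theorem absOfVal_strictAnti : StrictAnti (absOfVal p) := by
  intro a b hab
  induction a using WithTop.recTopCoe with
  | top => exact absurd hab not_top_lt
  | coe a =>
    induction b using WithTop.recTopCoe with
    | top => simpa [absOfVal_coe] using Real.rpow_pos_of_pos cast_prime_pos _
    | coe b =>
      rw [absOfVal_coe, absOfVal_coe]
      apply Real.rpow_lt_rpow_of_exponent_lt one_lt_cast_prime
      have : a < b := by exact_mod_cast hab
      have : (a : ℝ) < b := by exact_mod_cast this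
      linarith

theorem absOfVal_add (a b : WithTop ℚ) : absOfVal p (a + b) = absOfVal p a * absOfVal p b := by
  induction a using WithTop.recTopCoe with
  | top => simp
  | coe a =>
    induction b using WithTop.recTopCoe with
    | top => simp
    | coe b =>
      rw [← WithTop.coe_add, absOfVal_coe, absOfVal_coe, absOfVal_coe,
        ← Real.rpow_add cast_prime_pos]
      push_cast
      ring_nf

theorem absOfVal_zero {p : ℕ} : absOfVal p 0 = 1 := by
  have : absOfVal p ((0 : ℚ) : WithTop ℚ) = 1 := by rw [absOfVal_coe]; simp
  exact this

theorem absOfVal_nonneg (a : WithTop ℚ) : 0 ≤ absOfVal p a := by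
  have := (absOfVal_strictAnti (p := p)).antitone (le_top : a ≤ ⊤)
  simpa using this

/-- The absolute value attached to an additive valuation. -/
def AddVal.absoluteValue {K : Type} [Field K] (p : ℕ) [Fact p.Prime] (w : AddVal K) :
    AbsoluteValue K ℝ where
  toFun x := absOfVal p (w.v x)
  map_mul' x y := by rw [w.v_mul, absOfVal_add]
  nonneg' x := absOfVal_nonneg _
  eq_zero' x := by
    rw [← absOfVal_top (p := p), absOfVal_strictAnti.injective.eq_iff, w.v_eq_top_iff]
  add_le' x y := by
    have h := (absOfVal_strictAnti (p := p)).antitone (w.min_le_v_add x y)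
    rw [absOfVal_strictAnti.antitone.map_min] at h
    exact h.trans (max_le_add_of_nonneg (absOfVal_nonneg _) (absOfVal_nonneg _))

namespace PadicSetup

variable (S : PadicSetup p)

theorem absOfVal_vbar (x : Qpbar p) : absOfVal p (S.vbar.v x) = ‖x‖ := by
  refine spectralNorm_unique_field_norm_ext (K := ℚ_[p]) (f := S.vbar.absoluteValue p) ?_ x
  intro x
  change absOfVal p (S.vbar.v (algebraMap ℚ_[p] (Qpbar p) x)) = _
  by_cases hx : x = 0
  · subst hx
    rw [map_zero, (S.vbar.v_eq_top_iff 0).2 rfl]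
    simp
  · rw [S.vbar_extends x hx, absOfVal_coe, Padic.norm_eq_zpow_neg_valuation hx]
    have h : (-((x.valuation : ℚ) : ℝ)) = ((-x.valuation : ℤ) : ℝ) := by push_cast; rfl
    rw [h]
    exact Real.rpow_intCast _ _

theorem v_lt_v_iff {x y : Qpbar p} : S.vbar.v x < S.vbar.v y ↔ ‖y‖ < ‖x‖ := by
  rw [← S.absOfVal_vbar, ← S.absOfVal_vbar, absOfVal_strictAnti.lt_iff_gt]

theorem v_eq_v_iff {x y : Qpbar p} : S.vbar.v x = S.vbar.v y ↔ ‖x‖ = ‖y‖ := by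
  rw [← S.absOfVal_vbar, ← S.absOfVal_vbar, absOfVal_strictAnti.injective.eq_iff]

theorem v_nonneg_iff {x : Qpbar p} : 0 ≤ S.vbar.v x ↔ ‖x‖ ≤ 1 := by
  rw [← S.absOfVal_vbar, ← absOfVal_zero (p := p), absOfVal_strictAnti.le_iff_ge]

theorem v_pos_iff {x : Qpbar p} : 0 < S.vbar.v x ↔ ‖x‖ < 1 := by
  rw [← S.absOfVal_vbar, ← absOfVal_zero (p := p), absOfVal_strictAnti.lt_iff_gt]

end PadicSetup

theorem norm_qHomQpbar (c : ℚ) : ‖qHomQpbar p c‖ = ‖(c : ℚ_[p])‖ :=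
  PadicAlgCl.norm_extends p c

/-! ### The absolute value attached to a residually algebraic torsion extension -/

/-- Two elements are associated with respect to the valuation ring `W`. -/
def SameValue {K : Type} [Field K] (W : ValuationSubring K) (x y : K) : Prop :=
  x / y ∈ W ∧ y / x ∈ W

theorem SameValue.pow {K : Type} [Field K] {W : ValuationSubring K} {x y : K}
    (h : SameValue W x y) (n : ℕ) : SameValue W (x ^ n) (y ^ n) :=
  ⟨by rw [← div_pow]; exact pow_mem h.1 n, by rw [← div_pow]; exact pow_mem h.2 n⟩

theorem SameValue.mul {K : Type} [Field K] {W : ValuationSubring K} {x y x' y' : K}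
    (h : SameValue W x y) (h' : SameValue W x' y') : SameValue W (x * x') (y * y') :=
  ⟨by rw [mul_div_mul_comm]; exact mul_mem h.1 h'.1,
    by rw [mul_div_mul_comm]; exact mul_mem h.2 h'.2⟩

theorem SameValue.trans {K : Type} [Field K] {W : ValuationSubring K} {x y z : K} (hy : y ≠ 0)
    (h : SameValue W x y) (h' : SameValue W y z) : SameValue W x z :=
  ⟨by rw [← div_mul_div_cancel₀ hy]; exact mul_mem h.1 h'.1,
    by rw [← div_mul_div_cancel₀ hy]; exact mul_mem h'.2 h.2⟩

theorem SameValue.symm {K : Type} [Field K] {W : ValuationSubring K} {x y : K}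
    (h : SameValue W x y) : SameValue W y x := ⟨h.2, h.1⟩

theorem mem_of_pow_mem {K : Type} [Field K] {W : ValuationSubring K} {x : K} {n : ℕ}
    (hn : n ≠ 0) (h : x ^ n ∈ W) : x ∈ W := by
  rw [← W.valuation_le_one_iff] at h ⊢
  rw [map_pow] at h
  exact (pow_le_one_iff hn).1 h

theorem pow_mem_iff {K : Type} [Field K] {W : ValuationSubring K} {x : K} {n : ℕ}
    (hn : n ≠ 0) : x ^ n ∈ W ↔ x ∈ W := ⟨mem_of_pow_mem hn, fun h => pow_mem h n⟩

theorem exists_absoluteValue {W : ValuationSubring (RatFunc ℚ)} (hW : IsResAlgTorsionQ p W) :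
    ∃ w : AbsoluteValue (RatFunc ℚ) ℝ, IsNonarchimedean w ∧ (∀ φ, φ ∈ W ↔ w φ ≤ 1) ∧
      ∀ c : ℚ, w (RatFunc.C c) = ‖(c : ℚ_[p])‖ := by
  obtain ⟨hC, -, htor⟩ := hW
  have htor' : ∀ φ : RatFunc ℚ, ∃ n : ℕ, n ≠ 0 ∧ ∃ c : ℚ, (φ ≠ 0 → c ≠ 0 ∧
      SameValue W (φ ^ n) (RatFunc.C c)) ∧ (φ = 0 → c = 0) := by
    intro φ
    by_cases h : φ = 0
    · exact ⟨1, one_ne_zero, 0, by simp [h], by simp⟩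
    · obtain ⟨n, hn, c, hc, h1⟩ := htor φ h
      exact ⟨n, by omega, c, fun _ => ⟨hc, h1⟩, by simp [h]⟩
  choose n hn c hc hc0 using htor'
  have hC0 : ∀ {d : ℚ}, d ≠ 0 → (RatFunc.C d : RatFunc ℚ) ≠ 0 := fun h => by
    simpa using h
  have hsv : ∀ {a b : ℚ}, a ≠ 0 → b ≠ 0 → SameValue W (RatFunc.C a) (RatFunc.C b) →
      ‖(a : ℚ_[p])‖ = ‖(b : ℚ_[p])‖ := by
    intro a b ha hb h
    have hb' : (0 : ℝ) < ‖(b : ℚ_[p])‖ := norm_pos_iff.2 (by exact_mod_cast hb)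
    have ha' : (0 : ℝ) < ‖(a : ℚ_[p])‖ := norm_pos_iff.2 (by exact_mod_cast ha)
    have h1 := h.1
    have h2 := h.2
    rw [← map_div₀, hC] at h1 h2
    push_cast at h1 h2
    rw [norm_div, div_le_one (by assumption)] at h1 h2
    exact le_antisymm h1 h2
  set w : RatFunc ℚ → ℝ := fun φ => ‖(c φ : ℚ_[p])‖ ^ ((n φ : ℝ)⁻¹) with hw
  have hw0 : ∀ φ, 0 ≤ w φ := fun φ => by positivity
  have hwpow : ∀ φ, w φ ^ n φ = ‖(c φ : ℚ_[p])‖ := fun φ =>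
    Real.rpow_inv_natCast_pow (norm_nonneg _) (hn φ)
  have hw1 : ∀ φ, φ ∈ W ↔ w φ ≤ 1 := by
    intro φ
    by_cases h0 : φ = 0
    · have := hc0 φ h0
      have : w φ = 0 := by
        have h := hwpow φ
        rw [this] at h
        simpa [hn φ] using h
      rw [this, h0]
      simp [zero_mem]
    · obtain ⟨hcφ, hs⟩ := hc φ h0
      rw [← pow_le_one_iff_of_nonneg (hw0 φ) (hn φ), hwpow, ← hC, ← pow_mem_iff (hn φ)]
      constructor
      · intro h
        have := mul_mem hs.2 h
        rwa [div_mul_cancel₀ _ (pow_ne_zero _ h0)] at this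
      · intro h
        have := mul_mem hs.1 h
        rwa [div_mul_cancel₀ _ (hC0 hcφ)] at this
  have huniq : ∀ (φ : RatFunc ℚ) (m : ℕ) (d : ℚ), φ ≠ 0 → m ≠ 0 → d ≠ 0 →
      SameValue W (φ ^ m) (RatFunc.C d) → w φ ^ m = ‖(d : ℚ_[p])‖ := by
    intro φ m d h0 hm hd hs
    obtain ⟨hcφ, hs'⟩ := hc φ h0
    have h1 := hs.pow (n φ)
    have h2 := hs'.pow m
    rw [← pow_mul] at h1 h2
    rw [mul_comm] at h2
    have h3 := h2.symm.trans (pow_ne_zero _ h0) h1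
    rw [← map_pow, ← map_pow] at h3
    have h4 := hsv (pow_ne_zero _ hcφ) (pow_ne_zero _ hd) h3
    push_cast at h4
    rw [norm_pow, norm_pow, ← hwpow, ← pow_mul, mul_comm, pow_mul] at h4
    exact (pow_left_inj₀ (pow_nonneg (hw0 _) _) (norm_nonneg _) (hn φ)).1 h4
  have hwzero : ∀ φ, w φ = 0 ↔ φ = 0 := by
    intro φ
    have h := hwpow φ
    constructor
    · intro h1
      by_contra h0
      rw [h1, zero_pow (hn φ)] at h
      have := (hc φ h0).1
      apply this
      exact_mod_cast norm_eq_zero.1 h.symm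
    · intro h1
      rw [hc0 φ h1] at h
      simpa [hn φ] using h
  have hmul : ∀ φ ψ, w (φ * ψ) = w φ * w ψ := by
    intro φ ψ
    by_cases h0 : φ = 0
    · rw [(hwzero φ).2 h0, h0, zero_mul, zero_mul, (hwzero 0).2 rfl]
    by_cases h1 : ψ = 0
    · rw [(hwzero ψ).2 h1, h1, mul_zero, mul_zero, (hwzero 0).2 rfl]
    obtain ⟨hcφ, hs⟩ := hc φ h0
    obtain ⟨hcψ, ht⟩ := hc ψ h1
    have h2 := (hs.pow (n ψ)).mul (ht.pow (n φ))
    rw [← pow_mul, ← pow_mul, mul_comm (n ψ), ← mul_pow, ← map_pow, ← map_pow, ← map_mul] at h2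
    have h3 := huniq _ _ _ (mul_ne_zero h0 h1) (mul_ne_zero (hn φ) (hn ψ))
      (mul_ne_zero (pow_ne_zero _ hcφ) (pow_ne_zero _ hcψ)) h2
    push_cast at h3
    rw [norm_mul, norm_pow, norm_pow, ← hwpow, ← hwpow, ← pow_mul, ← pow_mul, mul_comm (n ψ),
      ← mul_pow] at h3
    exact (pow_left_inj₀ (hw0 _) (mul_nonneg (hw0 _) (hw0 _)) (mul_ne_zero (hn φ) (hn ψ))).1 h3
  have hone : w 1 = 1 := by
    have h : w 1 * w 1 = w 1 * 1 := by rw [← hmul, mul_one, mul_one]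
    exact mul_left_cancel₀ (fun h0 => one_ne_zero ((hwzero 1).1 h0)) h
  have hadd' : ∀ φ ψ, w φ ≤ w ψ → w (φ + ψ) ≤ w ψ := by
    intro φ ψ h
    by_cases h0 : ψ = 0
    · have h2 := (hwzero ψ).2 h0
      have : φ = 0 := (hwzero φ).1 (le_antisymm (h2 ▸ h) (hw0 φ))
      rw [this, zero_add]
    have hψ : 0 < w ψ := lt_of_le_of_ne (hw0 ψ) (fun h => h0 ((hwzero ψ).1 h.symm))
    have key : ∀ χ, w (χ / ψ) * w ψ = w χ := fun χ => by
      rw [← hmul, div_mul_cancel₀ _ h0]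
    have h1 : φ / ψ ∈ W := by
      rw [hw1]
      refine le_of_mul_le_mul_right ?_ hψ
      rw [key, one_mul]
      exact h
    have h2 : (φ + ψ) / ψ ∈ W := by
      rw [add_div, div_self h0]
      exact add_mem h1 (one_mem _)
    rw [← key, ← one_mul (w ψ), ← mul_assoc, mul_one]
    exact mul_le_mul_of_nonneg_right ((hw1 _).1 h2) hψ.le
  have hadd : ∀ φ ψ, w (φ + ψ) ≤ max (w φ) (w ψ) := by
    intro φ ψ
    rcases le_total (w φ) (w ψ) with h | h
    · exact (hadd' φ ψ h).trans (le_max_right _ _)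
    · rw [add_comm]
      exact (hadd' ψ φ h).trans (le_max_left _ _)
  refine ⟨{ toFun := w, map_mul' := hmul, nonneg' := hw0, eq_zero' := hwzero,
            add_le' := fun x y => (hadd x y).trans
              (max_le_add_of_nonneg (hw0 x) (hw0 y)) }, hadd, hw1, fun d => ?_⟩
  change w (RatFunc.C d) = _
  by_cases hd : d = 0
  · subst hd
    rw [map_zero, (hwzero 0).2 rfl]
    simp
  · have := huniq (RatFunc.C d) 1 d (hC0 hd) one_ne_zero hd (by
      rw [pow_one]
      have : (RatFunc.C d : RatFunc ℚ) / RatFunc.C d ∈ W := by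
        rw [div_self (hC0 hd)]
        exact one_mem _
      exact ⟨this, this⟩)
    simpa using this

end

section

variable {p}

/-! ### An ambient algebraically closed valued field -/

theorem exists_completion {K : Type} [Field K] (w : AbsoluteValue K ℝ) (hw : IsNonarchimedean w) :
    ∃ (L : Type) (_ : NormedField L) (_ : CompleteSpace L) (_ : IsUltrametricDist L)
      (i : K →+* L), (∀ x, ‖i x‖ = w x) ∧ DenseRange i := by
  let i : K →+* w.Completion :=
    (UniformSpace.Completion.coeRingHom).comp (WithAbs.equiv w).symm.toRingHom
  have hi : ∀ x, ‖i x‖ = w x := fun x => UniformSpace.Completion.norm_coe _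
  have hd : DenseRange i :=
    (UniformSpace.Completion.denseRange_coe).comp (WithAbs.equiv w).symm.surjective.denseRange
      (UniformSpace.Completion.continuous_coe _)
  refine ⟨w.Completion, inferInstance, inferInstance, ?_, i, hi, hd⟩
  apply IsUltrametricDist.isUltrametricDist_of_isNonarchimedean_norm
  intro x y
  refine DenseRange.induction_on₂ hd ?_ (fun a b => ?_) x y
  · exact isClosed_le (by fun_prop) (by fun_prop)
  · rw [← map_add, hi, hi, hi]
    exact hw a b

theorem exists_padic_hom {L : Type} [NormedField L] [CompleteSpace L] (h : ℚ →+* L)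
    (hh : ∀ q, ‖h q‖ = ‖(q : ℚ_[p])‖) : ∃ g : ℚ_[p] →+* L, ∀ x, ‖g x‖ = ‖x‖ := by
  let w : AbsoluteValue ℚ ℝ :=
    (NormedField.toAbsoluteValue ℚ_[p]).comp (f := Rat.castHom ℚ_[p]) (Rat.castHom ℚ_[p]).injective
  have hw : ∀ q, w q = ‖(q : ℚ_[p])‖ := fun q => rfl
  let i : WithAbs w →+* ℚ_[p] := (Rat.castHom ℚ_[p]).comp (WithAbs.equiv w).toRingHom
  let f : WithAbs w →+* L := h.comp (WithAbs.equiv w).toRingHom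
  have hi : Isometry i := AddMonoidHomClass.isometry_of_norm i fun x => rfl
  have hf : Isometry f := AddMonoidHomClass.isometry_of_norm f fun x => hh _
  have hd : DenseRange i := by
    intro x
    rw [Metric.mem_closure_range_iff]
    intro ε hε
    obtain ⟨r, hr⟩ := Padic.rat_dense p x hε
    exact ⟨WithAbs.toAbs w r, by rw [dist_eq_norm]; exact hr⟩
  let g := IsDenseInducing.extendRingHom hi.isUniformInducing hd hf.uniformContinuous
  have hgc : Continuous g :=
    (uniformContinuous_uniformly_extend hi.isUniformInducing hd hf.uniformContinuous).continuous
  refine ⟨g, fun x => ?_⟩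
  refine hd.induction_on x ?_ fun a => ?_
  · exact isClosed_eq (by fun_prop) (by fun_prop)
  · have : g (i a) = f a :=
      IsDenseInducing.extend_eq (hi.isUniformInducing.isDenseInducing hd) hf.continuous a
    rw [this]
    exact hh _

theorem exists_algebraicClosure {L : Type} [NontriviallyNormedField L] [CompleteSpace L]
    [IsUltrametricDist L] (g : ℚ_[p] →+* L) (hg : ∀ x, ‖g x‖ = ‖x‖) :
    ∃ (Ω : Type) (_ : NormedField Ω) (_ : IsUltrametricDist Ω) (e : L →+* Ω) (ι : Qpbar p →+* Ω),
      (∀ x, ‖e x‖ = ‖x‖) ∧ (∀ x, ‖ι x‖ = ‖x‖) ∧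
      (∀ x, ι (algebraMap ℚ_[p] (Qpbar p) x) = e (g x)) ∧
      ∀ x : Ω, ∃ f : L[X], f ≠ 0 ∧ f.eval₂ e x = 0 := by
  let _ : NormedField (AlgebraicClosure L) := spectralNorm.normedField L (AlgebraicClosure L)
  have he : ∀ x, ‖algebraMap L (AlgebraicClosure L) x‖ = ‖x‖ := fun x => spectralNorm_extends x
  let _ : Algebra ℚ_[p] (AlgebraicClosure L) := ((algebraMap L (AlgebraicClosure L)).comp g).toAlgebra
  let ι : Qpbar p →ₐ[ℚ_[p]] AlgebraicClosure L := IsAlgClosed.lift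
  refine ⟨AlgebraicClosure L, inferInstance, ?_, algebraMap L (AlgebraicClosure L), ι.toRingHom, he,
    fun x => ?_, fun x => ι.commutes x, fun x => ?_⟩
  · exact IsUltrametricDist.isUltrametricDist_of_isNonarchimedean_norm
      (isNonarchimedean_spectralNorm (K := L) (L := AlgebraicClosure L))
  · let w : AbsoluteValue (Qpbar p) ℝ :=
      (NormedField.toAbsoluteValue (AlgebraicClosure L)).comp (f := ι.toRingHom)
        ι.toRingHom.injective
    refine spectralNorm_unique_field_norm_ext (K := ℚ_[p]) (f := w) (fun y => ?_) x
    change ‖ι (algebraMap ℚ_[p] (Qpbar p) y)‖ = _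
    rw [ι.commutes, ← hg, ← he]
    rfl
  · obtain ⟨f, hf0, hf⟩ := Algebra.IsAlgebraic.isAlgebraic (R := L) x
    exact ⟨f, hf0, hf⟩

/-- A polynomial relation over a dense subfield can be approximated by one over the subfield. -/
theorem exists_almost_relation {K L Ω : Type} [Field K] [NormedField L] [NormedField Ω]
    [IsUltrametricDist Ω] (i : K →+* L) (hi : DenseRange i) (e : L →+* Ω) (he : ∀ x, ‖e x‖ = ‖x‖)
    {x : Ω} (hx : x ≠ 0) {f : L[X]} (hf : f ≠ 0) (hfx : f.eval₂ e x = 0) :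
    ∃ (n N : ℕ) (c : ℕ → K), N ≤ n ∧ c N ≠ 0 ∧
      (∀ k ≤ n, ‖e (i (c k)) * x ^ k‖ ≤ ‖e (i (c N)) * x ^ N‖) ∧
      ‖∑ k ∈ Finset.range (n + 1), e (i (c k)) * x ^ k‖ < ‖e (i (c N)) * x ^ N‖ := by
  set n := f.natDegree with hn
  obtain ⟨N, hN, hmax⟩ := Finset.exists_max_image (Finset.range (n + 1))
    (fun k => ‖e (f.coeff k) * x ^ k‖) ⟨0, by simp⟩
  set M := ‖e (f.coeff N) * x ^ N‖ with hM
  have hM0 : 0 < M := by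
    refine lt_of_lt_of_le ?_ (hmax n (by simp))
    rw [norm_pos_iff]
    refine mul_ne_zero ?_ (pow_ne_zero _ hx)
    simpa [hn] using hf
  have happ : ∀ k, ∃ c : K, ‖e (f.coeff k - i c) * x ^ k‖ < M := by
    intro k
    have hxk : 0 < ‖x ^ k‖ := norm_pos_iff.2 (pow_ne_zero _ hx)
    obtain ⟨c, hc⟩ := (Metric.mem_closure_range_iff.1 (hi (f.coeff k))) (M / ‖x ^ k‖)
      (div_pos hM0 hxk)
    refine ⟨c, ?_⟩
    rw [norm_mul, he, ← lt_div_iff₀ hxk, ← dist_eq_norm]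
    exact hc
  choose c hc using happ
  have hsplit : ∀ k, e (i (c k)) * x ^ k = e (f.coeff k) * x ^ k - e (f.coeff k - i (c k)) * x ^ k := by
    intro k
    rw [map_sub]
    ring
  have hle : ∀ k ≤ n, ‖e (i (c k)) * x ^ k‖ ≤ M := by
    intro k hk
    rw [hsplit, sub_eq_add_neg]
    refine (IsUltrametricDist.norm_add_le_max _ _).trans (max_le (hmax k (by simp; omega)) ?_)
    rw [norm_neg]
    exact (hc k).le
  have hN' : ‖e (i (c N)) * x ^ N‖ = M := by
    refine le_antisymm (hle N (by simpa [Nat.lt_succ_iff] using hN)) ?_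
    by_contra! hlt
    have h1 : e (f.coeff N) * x ^ N = e (i (c N)) * x ^ N + e (f.coeff N - i (c N)) * x ^ N := by
      rw [hsplit]
      ring
    have h2 := IsUltrametricDist.norm_add_le_max (e (i (c N)) * x ^ N)
      (e (f.coeff N - i (c N)) * x ^ N)
    rw [← h1] at h2
    exact absurd h2 (not_le.2 (max_lt hlt (hc N)))
  refine ⟨n, N, c, by simpa [Nat.lt_succ_iff] using hN, ?_, fun k hk => hN' ▸ hle k hk, ?_⟩
  · intro h0
    rw [h0] at hN'
    simp only [map_zero, zero_mul, norm_zero] at hN'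
    exact hM0.ne hN'
  · rw [hN']
    have h1 : ∑ k ∈ Finset.range (n + 1), e (i (c k)) * x ^ k =
        -∑ k ∈ Finset.range (n + 1), e (f.coeff k - i (c k)) * x ^ k := by
      rw [eval₂_eq_sum_range] at hfx
      simp_rw [hsplit, Finset.sum_sub_distrib]
      rw [hfx, zero_sub]
    rw [h1, norm_neg]
    obtain ⟨k, -, hk⟩ := IsUltrametricDist.exists_norm_finsetSum_le (Finset.range (n + 1))
      (fun k => e (f.coeff k - i (c k)) * x ^ k)
    exact hk.trans_lt (hc k)

theorem norm_sub_le_max {Ω : Type} [NormedField Ω] [IsUltrametricDist Ω] (x y : Ω) :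
    ‖x - y‖ ≤ max ‖x‖ ‖y‖ := by
  have := IsUltrametricDist.norm_add_le_max x (-y)
  rwa [norm_neg, ← sub_eq_add_neg] at this

/-- In an ultrametric field, if a finite sum is smaller than one of its terms of maximal norm, then
another term has the same norm. -/
theorem exists_ne_norm_eq {Ω : Type} [NormedField Ω] [IsUltrametricDist Ω] {s : Finset ℕ}
    {a : ℕ → Ω} {N : ℕ} (hN : N ∈ s) (hmax : ∀ k ∈ s, ‖a k‖ ≤ ‖a N‖)
    (hlt : ‖∑ k ∈ s, a k‖ < ‖a N‖) : ∃ k ∈ s, k ≠ N ∧ ‖a k‖ = ‖a N‖ := by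
  by_contra! h
  have h0 : 0 < ‖a N‖ := (norm_nonneg _).trans_lt hlt
  have h1 : ‖∑ k ∈ s.erase N, a k‖ < ‖a N‖ := by
    obtain ⟨k, hk, hk'⟩ := IsUltrametricDist.exists_norm_finsetSum_le (s.erase N) a
    rcases (s.erase N).eq_empty_or_nonempty with he | hne
    · rw [he]
      simpa using h0
    · have hk := hk hne
      exact hk'.trans_lt (lt_of_le_of_ne (hmax k (Finset.mem_of_mem_erase hk))
        (h k (Finset.mem_of_mem_erase hk) (Finset.ne_of_mem_erase hk)))
  have h2 : a N = ∑ k ∈ s, a k - ∑ k ∈ s.erase N, a k := by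
    rw [← Finset.add_sum_erase s a hN]
    ring
  have h3 := norm_sub_le_max (∑ k ∈ s, a k) (∑ k ∈ s.erase N, a k)
  rw [← h2] at h3
  exact absurd h3 (not_le.2 (max_lt hlt h1))

end

section

variable {p}

theorem residue_eq_zero_iff_norm_lt_one {F Ω : Type} [Field F] [NormedField Ω]
    {A : ValuationSubring F} {j : F →+* Ω} (hj : ∀ x, x ∈ A ↔ ‖j x‖ ≤ 1) (a : A) :
    IsLocalRing.residue A a = 0 ↔ ‖j a‖ < 1 := by
  rw [IsLocalRing.residue_eq_zero_iff, IsLocalRing.mem_maximalIdeal, mem_nonunits_iff, ← not_le,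
    not_iff_not]
  constructor
  · rintro ⟨b, rfl⟩
    have h1 : ‖j ((b⁻¹ : Aˣ) : A)‖ ≤ 1 := (hj _).1 (Subtype.prop _)
    have h2 : j (b : A) * j ((b⁻¹ : Aˣ) : A) = 1 := by
      rw [← map_mul, ← map_one j]
      congr 1
      exact congrArg Subtype.val b.mul_inv
    have h3 : ‖j (b : A)‖ * ‖j ((b⁻¹ : Aˣ) : A)‖ = 1 := by rw [← norm_mul, h2, norm_one]
    nlinarith [norm_nonneg (j (b : A))]
  · intro h
    have h0 : (a : F) ≠ 0 := by
      intro h0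
      rw [h0, map_zero, norm_zero] at h
      linarith
    have h1 : (a : F)⁻¹ ∈ A := by
      rw [hj, map_inv₀, norm_inv]
      exact inv_le_one_of_one_le₀ h
    exact IsUnit.of_mul_eq_one ⟨_, h1⟩ (Subtype.ext (mul_inv_cancel₀ h0))

theorem eval₂_eq_prod_roots {E : Type} [Field E] (ι : Qpbar p →+* E) (F : (Qpbar p)[X]) (x : E) :
    F.eval₂ ι x = ι F.leadingCoeff * (F.roots.map fun a => x - ι a).prod := by
  conv_lhs => rw [(IsAlgClosed.splits F).eq_prod_roots]
  rw [eval₂_mul, eval₂_C, eval₂_multiset_prod, Multiset.map_map]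
  simp

theorem exists_pow_eq_self_of_isAlgebraic {κ : Type} [Field κ] [Algebra (ZMod p) κ] {x : κ}
    (hx : IsAlgebraic (ZMod p) x) : ∃ q : ℕ, 1 < q ∧ x ^ q = x := by
  have := IntermediateField.adjoin.finiteDimensional hx.isIntegral
  have : Finite (IntermediateField.adjoin (ZMod p) {x}) := Module.finite_of_finite (ZMod p)
  have := Fintype.ofFinite (IntermediateField.adjoin (ZMod p) {x})
  refine ⟨Fintype.card (IntermediateField.adjoin (ZMod p) {x}), Fintype.one_lt_card, ?_⟩
  have := FiniteField.pow_card (IntermediateField.AdjoinSimple.gen (ZMod p) x)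
  exact congrArg Subtype.val this

theorem norm_eq_of_sameValue {Ω : Type} [NormedField Ω] {W : ValuationSubring (RatFunc ℚ)}
    {j : RatFunc ℚ →+* Ω} (hj : ∀ φ, φ ∈ W ↔ ‖j φ‖ ≤ 1) {φ ψ : RatFunc ℚ} (hφ : φ ≠ 0)
    (hψ : ψ ≠ 0) (h : SameValue W φ ψ) : ‖j φ‖ = ‖j ψ‖ := by
  have hφ' : 0 < ‖j φ‖ := by simpa using hφ
  have hψ' : 0 < ‖j ψ‖ := by simpa using hψ
  obtain ⟨h1, h2⟩ := h
  rw [hj, map_div₀, norm_div, div_le_one (by assumption)] at h1 h2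
  exact le_antisymm h1 h2

section Immediate

variable {Ω : Type} [NormedField Ω] [IsUltrametricDist Ω] {ι : Qpbar p →+* Ω}
  {W : ValuationSubring (RatFunc ℚ)} {j : RatFunc ℚ →+* Ω}

theorem exists_qpbar_norm_eq (hW : IsResAlgTorsionQ p W)
    (hj : ∀ φ, φ ∈ W ↔ ‖j φ‖ ≤ 1) {x : Ω} (hx : x ≠ 0) {n N : ℕ} {c : ℕ → RatFunc ℚ} (hN : N ≤ n)
    (hcN : c N ≠ 0) (hmax : ∀ k ≤ n, ‖j (c k) * x ^ k‖ ≤ ‖j (c N) * x ^ N‖)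
    (hlt : ‖∑ k ∈ Finset.range (n + 1), j (c k) * x ^ k‖ < ‖j (c N) * x ^ N‖) :
    ∃ b : Qpbar p, b ≠ 0 ∧ ‖ι b‖ = ‖x‖ := by
  have hx' : 0 < ‖x‖ := norm_pos_iff.2 hx
  obtain ⟨k, -, hkN, hk⟩ := exists_ne_norm_eq (s := Finset.range (n + 1)) (N := N)
    (by simp; omega) (fun k hk => hmax k (by simp at hk; omega)) hlt
  have hck : c k ≠ 0 := by
    intro h
    rw [h, map_zero, zero_mul, norm_zero] at hk
    have := hk.symm
    simp [hcN, hx] at this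
  have key : ∀ {k l : ℕ} {a b : RatFunc ℚ}, k < l → a ≠ 0 → b ≠ 0 →
      ‖j a * x ^ k‖ = ‖j b * x ^ l‖ →
      ∃ (m : ℕ) (ψ : RatFunc ℚ), m ≠ 0 ∧ ψ ≠ 0 ∧ ‖x‖ ^ m = ‖j ψ‖ := by
    intro k l a b hkl ha hb h
    refine ⟨l - k, a / b, by omega, div_ne_zero ha hb, ?_⟩
    have hb' : ‖j b‖ ≠ 0 := by simpa using hb
    rw [map_div₀, norm_div, eq_div_iff hb']
    rw [norm_mul, norm_mul, norm_pow, norm_pow] at h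
    have h2 : ‖x‖ ^ l = ‖x‖ ^ (l - k) * ‖x‖ ^ k := by rw [← pow_add]; congr 1; omega
    rw [h2, ← mul_assoc] at h
    rw [mul_comm]
    exact (mul_right_cancel₀ (pow_ne_zero k hx'.ne') h).symm
  obtain ⟨m, ψ, hm, hψ, hxm⟩ : ∃ (m : ℕ) (ψ : RatFunc ℚ), m ≠ 0 ∧ ψ ≠ 0 ∧ ‖x‖ ^ m = ‖j ψ‖ := by
    rcases lt_or_gt_of_ne hkN with h | h
    · exact key h hck hcN hk
    · exact key h hcN hck hk.symm
  obtain ⟨r, hr, d, hd, hs⟩ := hW.2.2 ψ hψ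
  have hd' : (RatFunc.C d : RatFunc ℚ) ≠ 0 := by simpa using hd
  have h1 := norm_eq_of_sameValue hj (pow_ne_zero r hψ) hd' hs
  rw [map_pow, norm_pow, ← hxm, ← pow_mul] at h1
  have hmr : 0 < m * r := by positivity
  obtain ⟨b, hb⟩ := IsAlgClosed.exists_pow_nat_eq (qHomQpbar p d) hmr
  have h2 : j (RatFunc.C d) = ι (qHomQpbar p d) :=
    congrArg (fun f : ℚ →+* Ω => f d) (Subsingleton.elim (j.comp RatFunc.C) (ι.comp (qHomQpbar p)))
  rw [h2, ← hb, map_pow, norm_pow] at h1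
  have h3 := (pow_left_inj₀ (norm_nonneg _) (norm_nonneg _) hmr.ne').1 h1
  refine ⟨b, ?_, h3.symm⟩
  rintro rfl
  rw [map_zero, norm_zero] at h3
  exact hx'.ne' h3

theorem exists_qpbar_norm_sub_lt_one (hι : ∀ x, ‖ι x‖ = ‖x‖) (hW : IsResAlgTorsionQ p W)
    (hj : ∀ φ, φ ∈ W ↔ ‖j φ‖ ≤ 1) {u : Ω} (hu : ‖u‖ = 1) {n N : ℕ} {c : ℕ → RatFunc ℚ} (hN : N ≤ n)
    (hcN : c N ≠ 0) (hmax : ∀ k ≤ n, ‖j (c k) * u ^ k‖ ≤ ‖j (c N) * u ^ N‖)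
    (hlt : ‖∑ k ∈ Finset.range (n + 1), j (c k) * u ^ k‖ < ‖j (c N) * u ^ N‖) :
    ∃ b : Qpbar p, ‖u - ι b‖ < 1 := by
  let O : ValuationSubring Ω := (NormedField.valuation (K := Ω)).valuationSubring
  have hO : ∀ x, x ∈ O ↔ ‖RingHom.id Ω x‖ ≤ 1 := fun x => Iff.rfl
  have hres := residue_eq_zero_iff_norm_lt_one hO
  have hresW := residue_eq_zero_iff_norm_lt_one hj
  have hjp : ‖j p‖ < 1 := by
    rw [map_natCast, ← map_natCast ι, hι, ← map_natCast (algebraMap ℚ_[p] (Qpbar p)),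
      PadicAlgCl.norm_extends p]
    exact Padic.norm_p_lt_one
  have : CharP (IsLocalRing.ResidueField O) p := by
    rw [CharP.charP_iff_prime_eq_zero Fact.out, ← map_natCast (IsLocalRing.residue O), hres]
    simpa using hjp
  let _ : Algebra (ZMod p) (IsLocalRing.ResidueField O) := ZMod.algebra _ p
  let κ₀ := algebraicClosure (ZMod p) (IsLocalRing.ResidueField O)
  have hjO : ∀ φ : W, j φ ∈ O := fun φ => (hj _).1 φ.2
  have hκ₀ : ∀ φ : W, IsLocalRing.residue O ⟨j φ, hjO φ⟩ ∈ κ₀ := by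
    intro φ
    rw [mem_algebraicClosure_iff]
    obtain ⟨k, hk, h⟩ := hW.2.1 (IsLocalRing.residue W φ)
    rw [← map_pow, ← sub_eq_zero, ← map_sub, hresW] at h
    refine ⟨X ^ p ^ k - X, FiniteField.X_pow_card_sub_X_ne_zero _
      (Nat.one_lt_pow (by omega) (Fact.out : p.Prime).one_lt), ?_⟩
    rw [map_sub, map_pow, aeval_X, ← map_pow, ← map_sub, hres]
    simpa using h
  have hcN' : 0 < ‖j (c N)‖ := by simpa using hcN
  have ha : ∀ k, k ≤ n → c k / c N ∈ W := by
    intro k hk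
    have := hmax k hk
    rw [norm_mul, norm_mul, norm_pow, norm_pow, hu, one_pow, one_pow, mul_one, mul_one] at this
    rw [hj, map_div₀, norm_div]
    exact (div_le_one hcN').2 this
  let a : ℕ → W := fun k => if hk : k ≤ n then ⟨c k / c N, ha k hk⟩ else 0
  have hak : ∀ k ≤ n, (a k : RatFunc ℚ) = c k / c N := fun k hk => by simp [a, hk]
  let u' : O := ⟨u, hu.le⟩
  let P : κ₀[X] := ∑ k ∈ Finset.range (n + 1), C ⟨_, hκ₀ (a k)⟩ * X ^ k
  have hP0 : P ≠ 0 := by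
    intro h
    have h1 : P.coeff N = 0 := by rw [h, coeff_zero]
    simp only [P, finsetSum_coeff, coeff_C_mul_X_pow] at h1
    rw [Finset.sum_ite_eq, if_pos (by simp; omega)] at h1
    have h2 := congrArg Subtype.val h1
    change IsLocalRing.residue O ⟨j (a N), hjO _⟩ = 0 at h2
    rw [hres] at h2
    simp [hak N hN, hcN] at h2
  have hPu : aeval (IsLocalRing.residue O u') P = 0 := by
    have h1 : aeval (IsLocalRing.residue O u') P =
        IsLocalRing.residue O (∑ k ∈ Finset.range (n + 1), ⟨j (a k), hjO _⟩ * u' ^ k) := by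
      simp only [P, map_sum, map_mul, map_pow, aeval_C, aeval_X]
      rfl
    rw [h1, hres]
    have h2 : (((∑ k ∈ Finset.range (n + 1), ⟨j (a k), hjO _⟩ * u' ^ k : O)) : Ω) =
        (∑ k ∈ Finset.range (n + 1), j (c k) * u ^ k) / j (c N) := by
      rw [Finset.sum_div]
      push_cast
      refine Finset.sum_congr rfl fun k hk => ?_
      rw [hak k (by simp at hk; omega), map_div₀]
      ring
    rw [h2, RingHom.id_apply, norm_div, div_lt_one hcN']
    simpa [hu] using hlt
  have hualg : IsAlgebraic (ZMod p) (IsLocalRing.residue O u') :=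
    IsAlgebraic.restrictScalars (S := κ₀) (ZMod p) ⟨P, hP0, hPu⟩
  obtain ⟨q, hq, h⟩ := exists_pow_eq_self_of_isAlgebraic hualg
  rw [← map_pow, ← sub_eq_zero, ← map_sub, hres] at h
  have hmon : (X ^ q - X : (Qpbar p)[X]).Monic :=
    monic_X_pow_sub (by simpa using hq)
  have h3 := eval₂_eq_prod_roots ι (X ^ q - X) u
  rw [hmon.leadingCoeff, map_one, one_mul, eval₂_sub, eval₂_X_pow, eval₂_X] at h3
  by_contra! hcon
  have h4 : 1 ≤ ‖(((X ^ q - X : (Qpbar p)[X]).roots).map fun a => u - ι a).prod‖ := by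
    refine Multiset.prod_induction (fun y => 1 ≤ ‖y‖) _ (fun a b ha hb => ?_) (by simp) ?_
    · rw [norm_mul]
      exact one_le_mul_of_one_le_of_one_le ha hb
    · intro y hy
      obtain ⟨b, -, rfl⟩ := Multiset.mem_map.1 hy
      exact hcon b
  rw [← h3] at h4
  have h5 : ‖u ^ q - u‖ < 1 := by simpa using h
  linarith

end Immediate

end

section

variable {p}

/-! ### Discrete valuations with finite residue field -/

theorem totallyBounded_closedBall_of_finite_residueField {K L : Type} [Field K] [NormedField L]
    [IsUltrametricDist L] {W : ValuationSubring K} {i : K →+* L} (hi : DenseRange i)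
    (hiW : ∀ φ, φ ∈ W ↔ ‖i φ‖ ≤ 1) [Finite (IsLocalRing.ResidueField W)] {ϖ : K}
    (hϖ0 : ϖ ≠ 0) (hϖ1 : ‖i ϖ‖ < 1) (hϖ : ∀ φ, ‖i φ‖ < 1 → ‖i φ‖ ≤ ‖i ϖ‖) :
    TotallyBounded (Metric.closedBall (0 : L) 1) := by
  have hπ : 0 < ‖i ϖ‖ := by simpa using hϖ0
  have hiϖ : i ϖ ≠ 0 := norm_pos_iff.1 hπ
  obtain ⟨r, hr⟩ := (IsLocalRing.residue_surjective (R := W)).hasRightInverse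
  have key : ∀ n : ℕ, ∃ T : Set L, T.Finite ∧ ∀ x : L, ‖x‖ ≤ 1 → ∃ t ∈ T, ‖x - t‖ ≤ ‖i ϖ‖ ^ n := by
    intro n
    induction n with
    | zero => exact ⟨{0}, Set.finite_singleton _, fun x hx => ⟨0, rfl, by simpa using hx⟩⟩
    | succ n ih =>
      obtain ⟨T, hT, h⟩ := ih
      refine ⟨Set.image2 (fun t κ => t + i ϖ ^ n * i (r κ)) T Set.univ,
        hT.image2 _ Set.finite_univ, fun x hx => ?_⟩
      obtain ⟨t, ht, hxt⟩ := h x hx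
      have hn : 0 < ‖i ϖ‖ ^ n := pow_pos hπ n
      obtain ⟨y, hy⟩ : ∃ y, y = (x - t) / i ϖ ^ n := ⟨_, rfl⟩
      have hy1 : ‖y‖ ≤ 1 := by rwa [hy, norm_div, norm_pow, div_le_one hn]
      obtain ⟨φ, hφ⟩ := Metric.mem_closure_range_iff.1 (hi y) _ hπ
      rw [dist_eq_norm] at hφ
      have hφW : φ ∈ W := by
        rw [hiW, show i φ = y - (y - i φ) by ring]
        exact (norm_sub_le_max _ _).trans (max_le hy1 (hφ.le.trans hϖ1.le))
      have hres : ‖i ((⟨φ, hφW⟩ - r (IsLocalRing.residue W ⟨φ, hφW⟩) : W) : K)‖ < 1 := by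
        rw [← residue_eq_zero_iff_norm_lt_one hiW, map_sub, hr, sub_self]
      refine ⟨_, ⟨t, ht, IsLocalRing.residue W ⟨φ, hφW⟩, Set.mem_univ _, rfl⟩, ?_⟩
      have h2 := hϖ _ hres
      have h3 : x - (t + i ϖ ^ n * i (r (IsLocalRing.residue W ⟨φ, hφW⟩))) =
          i ϖ ^ n * ((y - i φ) +
            i ((⟨φ, hφW⟩ - r (IsLocalRing.residue W ⟨φ, hφW⟩) : W) : K)) := by
        have : x - t = i ϖ ^ n * y := by
          rw [hy, mul_div_cancel₀ _ (pow_ne_zero _ hiϖ)]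
        rw [← sub_sub, this]
        push_cast
        rw [map_sub]
        ring
      rw [h3, norm_mul, norm_pow, pow_succ]
      gcongr
      exact (IsUltrametricDist.norm_add_le_max _ _).trans (max_le hφ.le h2)
  rw [Metric.totallyBounded_iff]
  intro ε hε
  obtain ⟨n, hn⟩ := exists_pow_lt_of_lt_one hε hϖ1
  obtain ⟨T, hT, h⟩ := key n
  refine ⟨T, hT, fun x hx => ?_⟩
  obtain ⟨t, ht, hxt⟩ := h x (by simpa using hx)
  simp only [Set.mem_iUnion, Metric.mem_ball, dist_eq_norm]
  exact ⟨t, ht, hxt.trans_lt hn⟩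

theorem exists_uniformizer {K L : Type} [Field K] [NormedField L] {i : K →+* L} {N : ℕ}
    (hN : 0 < N) (h : ∀ φ, φ ≠ 0 → ∃ k : ℤ, ‖i φ‖ ^ N = (p : ℝ) ^ (-k)) (hp : ‖i p‖ < 1)
    (hp0 : (p : K) ≠ 0) :
    ∃ ϖ, ϖ ≠ 0 ∧ ‖i ϖ‖ < 1 ∧ ∀ φ, ‖i φ‖ < 1 → ‖i φ‖ ≤ ‖i ϖ‖ := by
  classical
  have h' : ∀ φ, φ ≠ 0 → ‖i φ‖ < 1 → ∃ m : ℕ, ‖i φ‖ ^ N = (p : ℝ) ^ (-(m : ℤ)) := by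
    intro φ hφ hφ1
    obtain ⟨k, hk⟩ := h φ hφ
    have hlt : (p : ℝ) ^ (-k) < (p : ℝ) ^ (0 : ℤ) := by
      rw [← hk, zpow_zero]
      exact pow_lt_one₀ (norm_nonneg _) hφ1 hN.ne'
    rw [zpow_lt_zpow_iff_right₀ one_lt_cast_prime] at hlt
    obtain ⟨m, rfl⟩ := Int.eq_ofNat_of_zero_le (a := k) (by omega)
    exact ⟨m, hk⟩
  have hex : ∃ m : ℕ, ∃ φ, φ ≠ 0 ∧ ‖i φ‖ < 1 ∧ ‖i φ‖ ^ N = (p : ℝ) ^ (-(m : ℤ)) := by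
    obtain ⟨m, hm⟩ := h' p hp0 hp
    exact ⟨m, p, hp0, hp, hm⟩
  obtain ⟨ϖ, h0, h1, h2⟩ := Nat.find_spec hex
  refine ⟨ϖ, h0, h1, fun φ hφ1 => ?_⟩
  by_cases hφ : φ = 0
  · simp [hφ]
  obtain ⟨m, hm⟩ := h' φ hφ hφ1
  have hle := Nat.find_min' hex ⟨φ, hφ, hφ1, hm⟩
  refine le_of_pow_le_pow_left₀ hN.ne' (norm_nonneg _) ?_
  rw [hm, h2, zpow_le_zpow_iff_right₀ one_lt_cast_prime]
  omega

theorem mem_range_of_finiteDimensional {L Ω : Type} [NormedField L] [CompleteSpace L] [Field Ω]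
    (g : ℚ_[p] →+* L) (hg : ∀ x, ‖g x‖ = ‖x‖) (hL : TotallyBounded (Metric.closedBall (0 : L) 1))
    (e : L →+* Ω) (ι : Qpbar p →+* Ω) (hι : ∀ x, ι (algebraMap ℚ_[p] (Qpbar p) x) = e (g x))
    (x : L) : e x ∈ Set.range ι := by
  let _ : Algebra ℚ_[p] L := g.toAlgebra
  let _ : NormedAlgebra ℚ_[p] L :=
    ⟨fun a b => by rw [show a • b = g a * b from rfl, norm_mul, hg]⟩
  have hfin : FiniteDimensional ℚ_[p] L :=
    FiniteDimensional.of_isCompact_closedBall₀ ℚ_[p] one_pos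
      (isCompact_iff_totallyBounded_isComplete.2 ⟨hL, Metric.isClosed_closedBall.isComplete⟩)
  obtain ⟨f, hf0, hf⟩ := Algebra.IsAlgebraic.isAlgebraic (R := ℚ_[p]) x
  have h1 : (f.map (algebraMap ℚ_[p] (Qpbar p))).eval₂ ι (e x) = 0 := by
    rw [eval₂_map, show ι.comp (algebraMap ℚ_[p] (Qpbar p)) = e.comp g from RingHom.ext hι,
      ← hom_eval₂]
    change e (f.aeval x) = 0
    rw [hf, map_zero]
  rw [eval₂_eq_prod_roots, mul_eq_zero, Multiset.prod_eq_zero_iff, Multiset.mem_map] at h1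
  rcases h1 with h1 | ⟨a, -, ha⟩
  · simp [hf0] at h1
  · exact ⟨a, (sub_eq_zero.1 ha).symm⟩

/-! ### The ambient valued field -/

theorem IsResAlgTorsionQ.exists_ambient {W : ValuationSubring (RatFunc ℚ)}
    (hW : IsResAlgTorsionQ p W) :
    ∃ (Ω : Type) (_ : NormedField Ω) (_ : IsUltrametricDist Ω) (ι : Qpbar p →+* Ω)
      (j : RatFunc ℚ →+* Ω), (∀ x, ‖ι x‖ = ‖x‖) ∧ (∀ φ, φ ∈ W ↔ ‖j φ‖ ≤ 1) ∧
      (∀ x : Ω, x ≠ 0 → ∃ b, ‖x - ι b‖ < ‖x‖) ∧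
      (((∃ N : ℕ, 0 < N ∧ ∀ φ : RatFunc ℚ, φ ≠ 0 → ∃ c : ℚ, c ≠ 0 ∧
          φ ^ N / RatFunc.C c ∈ W ∧ RatFunc.C c / φ ^ N ∈ W) ∧
        Finite (IsLocalRing.ResidueField W)) → j RatFunc.X ∈ Set.range ι) := by
  obtain ⟨w, hwna, hwW, hwC⟩ := exists_absoluteValue hW
  obtain ⟨L, _, _, _, i, hi, hid⟩ := exists_completion w hwna
  obtain ⟨g, hg⟩ := exists_padic_hom (i.comp RatFunc.C) fun q => (hi _).trans (hwC q)
  have hiC : ∀ q, ‖i (RatFunc.C q)‖ = ‖(q : ℚ_[p])‖ := fun q => (hi _).trans (hwC q)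
  have hip : ‖i p‖ = ‖(p : ℚ_[p])‖ := by simpa using hiC p
  let _ : NontriviallyNormedField L :=
    NontriviallyNormedField.ofNormNeOne ⟨i p, by
      rw [← norm_ne_zero_iff, hip]
      simp [(Fact.out : p.Prime).ne_zero], by
      rw [hip]
      exact Padic.norm_p_lt_one.ne⟩
  obtain ⟨Ω, _, _, e, ι, he, hι, hιg, halg⟩ := exists_algebraicClosure g hg
  have hj : ∀ φ, φ ∈ W ↔ ‖(e.comp i) φ‖ ≤ 1 := fun φ => by
    rw [hwW, RingHom.comp_apply, he, hi]
  refine ⟨Ω, _, ‹_›, ι, e.comp i, hι, hj, fun x hx => ?_, fun h3 => ?_⟩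
  · have hrel : ∀ y : Ω, y ≠ 0 → ∃ (n N : ℕ) (c : ℕ → RatFunc ℚ), N ≤ n ∧ c N ≠ 0 ∧
      (∀ k ≤ n, ‖(e.comp i) (c k) * y ^ k‖ ≤ ‖(e.comp i) (c N) * y ^ N‖) ∧
      ‖∑ k ∈ Finset.range (n + 1), (e.comp i) (c k) * y ^ k‖ < ‖(e.comp i) (c N) * y ^ N‖ := by
      intro y hy
      obtain ⟨f, hf, hfy⟩ := halg y
      exact exists_almost_relation i hid e he hy hf hfy
    obtain ⟨n, N, c, h1, h2, h3, h4⟩ := hrel x hx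
    obtain ⟨b, hb, hbx⟩ := exists_qpbar_norm_eq hW hj hx h1 h2 h3 h4
    have hιb : ι b ≠ 0 := by simpa using hb
    have hxn : 0 < ‖x‖ := norm_pos_iff.2 hx
    have hu : ‖x / ι b‖ = 1 := by rw [norm_div, hbx, div_self hxn.ne']
    obtain ⟨n, N, c, h1, h2, h3, h4⟩ := hrel (x / ι b) (div_ne_zero hx hιb)
    obtain ⟨z, hz⟩ := exists_qpbar_norm_sub_lt_one hι hW hj hu h1 h2 h3 h4
    refine ⟨b * z, ?_⟩
    rw [map_mul, show x - ι b * ι z = (x / ι b - ι z) * ι b by field_simp, norm_mul, hbx]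
    exact mul_lt_of_lt_one_left hxn hz
  · obtain ⟨⟨N, hN, hram⟩, hfin⟩ := h3
    have hiW : ∀ φ, φ ∈ W ↔ ‖i φ‖ ≤ 1 := fun φ => by rw [hwW, hi]
    obtain ⟨ϖ, h0, h1, h2⟩ := exists_uniformizer (p := p) (i := i) hN (fun φ hφ => by
      obtain ⟨c, hc, hcφ⟩ := hram φ hφ
      have := norm_eq_of_sameValue (j := i) hiW (pow_ne_zero N hφ) (by simpa using hc) hcφ
      rw [map_pow, norm_pow, hiC, Padic.norm_eq_zpow_neg_valuation (by simpa using hc)] at this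
      exact ⟨_, this⟩) (hip.trans_lt Padic.norm_p_lt_one)
      (by simp [(Fact.out : p.Prime).ne_zero])
    exact mem_range_of_finiteDimensional g hg
      (totallyBounded_closedBall_of_finite_residueField hid hiW h0 h1 h2) e ι hιg _

end

section

variable {p}

/-! ### Evaluating rational functions -/

theorem ratFunc_eval_div {K F : Type} [Field K] [Field F] (h : K →+* F) (a : F) (f g : K[X])
    (hg : g.eval₂ h a ≠ 0) :
    (algebraMap K[X] (RatFunc K) f / algebraMap K[X] (RatFunc K) g).denom.eval₂ h a ≠ 0 ∧
      (algebraMap K[X] (RatFunc K) f / algebraMap K[X] (RatFunc K) g).eval h a =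
        f.eval₂ h a / g.eval₂ h a := by
  have hg0 : g ≠ 0 := by
    rintro rfl
    simp at hg
  set φ := algebraMap K[X] (RatFunc K) f / algebraMap K[X] (RatFunc K) g with hφ
  have hd : φ.denom.eval₂ h a ≠ 0 := fun h0 =>
    hg (eval₂_eq_zero_of_dvd_of_eval₂_eq_zero h a (RatFunc.denom_div_dvd f g) h0)
  refine ⟨hd, ?_⟩
  have := congrArg (eval₂ h a) ((RatFunc.num_mul_eq_mul_denom_iff hg0).2 hφ)
  rw [eval₂_mul, eval₂_mul] at this
  rw [RatFunc.eval, div_eq_div_iff hd hg, this]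

theorem map_ratFunc_eval {K F E : Type} [Field K] [Field F] [Field E] (h : K →+* F) (ι : F →+* E)
    (a : F) (φ : RatFunc K) : ι (φ.eval h a) = φ.eval (ι.comp h) (ι a) := by
  rw [RatFunc.eval, map_div₀, hom_eval₂, hom_eval₂, RatFunc.eval]

/-- Evaluation at a transcendental element, as a ring homomorphism. -/
def ratFuncEvalHom {K F : Type} [Field K] [Field F] (h : K →+* F) (a : F) (ha : IsTranscOver h a) :
    RatFunc K →+* F where
  toFun := RatFunc.eval h a
  map_one' := RatFunc.eval_one h a
  map_zero' := RatFunc.eval_zero h a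
  map_mul' φ ψ := RatFunc.eval_mul h a (ha _ φ.denom_ne_zero) (ha _ ψ.denom_ne_zero)
  map_add' φ ψ := RatFunc.eval_add h a (ha _ φ.denom_ne_zero) (ha _ ψ.denom_ne_zero)

theorem map_algebraMap_eq_eval₂ {K F : Type} [Field K] [Field F] (j : RatFunc K →+* F) (f : K[X]) :
    j (algebraMap K[X] (RatFunc K) f) = f.eval₂ (j.comp RatFunc.C) (j RatFunc.X) := by
  have : j.comp (algebraMap K[X] (RatFunc K)) = eval₂RingHom (j.comp RatFunc.C) (j RatFunc.X) := by
    ext <;> simp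
  exact congrArg (fun t : K[X] →+* F => t f) this

theorem isTranscOver_map_X {K F : Type} [Field K] [Field F] (j : RatFunc K →+* F) :
    IsTranscOver (j.comp RatFunc.C) (j RatFunc.X) := by
  intro f hf
  rw [← map_algebraMap_eq_eval₂]
  simpa using hf

theorem map_eq_ratFunc_eval {K F : Type} [Field K] [Field F] (j : RatFunc K →+* F)
    (φ : RatFunc K) : j φ = φ.eval (j.comp RatFunc.C) (j RatFunc.X) := by
  rw [RatFunc.eval, ← map_algebraMap_eq_eval₂, ← map_algebraMap_eq_eval₂, ← map_div₀,
    RatFunc.num_div_denom]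

/-! ### Approximating sequences -/

theorem norm_sub_eq_of_norm_lt {Ω : Type} [NormedField Ω] [IsUltrametricDist Ω] {a b : Ω}
    (h : ‖b‖ < ‖a‖) : ‖a - b‖ = ‖a‖ := by
  refine le_antisymm ((norm_sub_le_max a b).trans (max_le le_rfl h.le)) ?_
  have h1 := IsUltrametricDist.norm_add_le_max (a - b) b
  rw [sub_add_cancel] at h1
  exact (le_max_iff.1 h1).resolve_right (not_le.2 h)

section Approx

variable {Ω : Type} [NormedField Ω] {ι : Qpbar p →+* Ω} {y : Ω} {s : ℕ → Qpbar p}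

/-- `s` approaches `y` at least as well as any element of `Q̄_p` other than `y`. -/
structure IsApprox (ι : Qpbar p →+* Ω) (y : Ω) (s : ℕ → Qpbar p) : Prop where
  strictAnti : StrictAnti fun n => ‖y - ι (s n)‖
  eventually_lt : ∀ a, ι a ≠ y → ∀ᶠ n in atTop, ‖y - ι (s n)‖ < ‖y - ι a‖

theorem exists_isApprox (hι : ∀ x, ‖ι x‖ = ‖x‖) (himm : ∀ x : Ω, x ≠ 0 → ∃ b, ‖x - ι b‖ < ‖x‖)
    (y : Ω) : ∃ s, IsApprox ι y s := by
  set T : Set ℝ := {r | ∃ a, ι a ≠ y ∧ r = ‖y - ι a‖} with hT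
  have hne : T.Nonempty := by
    by_cases h : y = 0
    · exact ⟨_, 1, by simp [h], rfl⟩
    · exact ⟨_, 0, by simpa using Ne.symm h, rfl⟩
  have hglb : IsGLB T (sInf T) := isGLB_csInf hne ⟨0, by rintro r ⟨a, -, rfl⟩; positivity⟩
  have hlt : ∀ a, ι a ≠ y → ∃ r ∈ T, r < ‖y - ι a‖ := by
    intro a ha
    have ha' : y - ι a ≠ 0 := sub_ne_zero.2 ha.symm
    obtain ⟨b, hb⟩ := himm _ ha'
    by_cases h : ι (a + b) = y
    · obtain ⟨c, hc0, hc⟩ := NormedField.exists_norm_lt (Qpbar p) (norm_pos_iff.2 ha')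
      refine ⟨_, ⟨a + b + c, ?_, rfl⟩, ?_⟩
      · rw [map_add, h]
        simpa using hc0
      · rw [map_add, h]
        simpa [hι] using hc
    · refine ⟨_, ⟨a + b, h, rfl⟩, ?_⟩
      rwa [map_add, ← sub_sub]
  have hnot : ∀ a, ι a ≠ y → sInf T < ‖y - ι a‖ := by
    intro a ha
    obtain ⟨r, hr, hlt⟩ := hlt a ha
    exact (hglb.1 hr).trans_lt hlt
  obtain ⟨u, hu, -, hlim, huT⟩ := hglb.exists_seq_strictAnti_tendsto_of_notMem
    (fun ⟨a, ha, h⟩ => (hnot a ha).ne h) hne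
  choose s _ hs using huT
  have hs' : (fun n => ‖y - ι (s n)‖) = u := (funext hs).symm
  exact ⟨s, hs' ▸ hu, fun a ha => by
    filter_upwards [hlim.eventually (gt_mem_nhds (hnot a ha))] with n hn
    rwa [← hs n]⟩

variable [IsUltrametricDist Ω]

theorem IsApprox.isPseudoConvergent (hs : IsApprox ι y s) (hι : ∀ x, ‖ι x‖ = ‖x‖)
    (S : PadicSetup p) : S.vbar.IsPseudoConvergent s := by
  have key : ∀ n m, n < m → ‖s n - s m‖ = ‖y - ι (s n)‖ := by
    intro n m hnm
    rw [norm_sub_rev, ← hι, map_sub, show ι (s m) - ι (s n) = (y - ι (s n)) - (y - ι (s m)) by ring]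
    exact norm_sub_eq_of_norm_lt (hs.strictAnti hnm)
  intro n m k hnm hmk
  rw [S.v_lt_v_iff, key n m hnm, key m k hmk]
  exact hs.strictAnti hnm

theorem IsApprox.eventually_norm_eval (hs : IsApprox ι y s) (hι : ∀ x, ‖ι x‖ = ‖x‖)
    (F : (Qpbar p)[X]) (hF : F.eval₂ ι y ≠ 0) :
    ∀ᶠ n in atTop, ‖F.eval (s n)‖ = ‖F.eval₂ ι y‖ := by
  classical
  have hroot : ∀ a ∈ F.roots.toFinset, ι a ≠ y := by
    rintro a ha rfl
    rw [Multiset.mem_toFinset, mem_roots', IsRoot.def] at ha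
    rw [eval₂_hom, ha.2, map_zero] at hF
    exact hF rfl
  have hev : ∀ᶠ n in atTop, ∀ a ∈ F.roots.toFinset, ‖y - ι (s n)‖ < ‖y - ι a‖ :=
    (eventually_all_finset _).2 fun a ha => hs.eventually_lt a (hroot a ha)
  filter_upwards [hev] with n hn
  rw [← hι, ← eval₂_hom, eval₂_eq_prod_roots, eval₂_eq_prod_roots, norm_mul, norm_mul]
  congr 1
  change (normHom : Ω →*₀ ℝ) _ = (normHom : Ω →*₀ ℝ) _
  rw [map_multiset_prod, map_multiset_prod, Multiset.map_map, Multiset.map_map]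
  congr 1
  refine Multiset.map_congr rfl fun a ha => ?_
  have h := norm_sub_eq_of_norm_lt (hn a (Multiset.mem_toFinset.2 ha))
  rw [show y - ι a - (y - ι (s n)) = ι (s n) - ι a by ring] at h
  exact h

theorem IsApprox.eventually_norm_eval₂ (hs : IsApprox ι y s) (hι : ∀ x, ‖ι x‖ = ‖x‖)
    {K : Type} [Field K] {h : K →+* Qpbar p} {F : K[X]} (hF : F.eval₂ (ι.comp h) y ≠ 0) :
    ∀ᶠ n in atTop, ‖F.eval₂ h (s n)‖ = ‖F.eval₂ (ι.comp h) y‖ := by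
  rw [← eval₂_map] at hF
  filter_upwards [hs.eventually_norm_eval hι _ hF] with n hn
  rwa [eval_map, eval₂_map] at hn

theorem IsApprox.eventually_norm_ratFunc_eval (hs : IsApprox ι y s) (hι : ∀ x, ‖ι x‖ = ‖x‖)
    {K : Type} [Field K] {h : K →+* Qpbar p} (hy : IsTranscOver (ι.comp h) y) (φ : RatFunc K) :
    ∀ᶠ n in atTop, φ.denom.eval₂ h (s n) ≠ 0 ∧ ‖φ.eval h (s n)‖ = ‖φ.eval (ι.comp h) y‖ := by
  have hd := hy _ φ.denom_ne_zero
  by_cases hφ : φ = 0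
  · simp [hφ]
  filter_upwards [hs.eventually_norm_eval₂ hι hd,
    hs.eventually_norm_eval₂ hι (hy _ (RatFunc.num_ne_zero hφ))] with n h1 h2
  refine ⟨?_, ?_⟩
  · rwa [← norm_ne_zero_iff, h1, norm_ne_zero_iff]
  · rw [RatFunc.eval, RatFunc.eval, norm_div, norm_div, h1, h2]

theorem IsApprox.isTranscendentalTypeOver (hs : IsApprox ι y s) (hι : ∀ x, ‖ι x‖ = ‖x‖)
    {K : Type} [Field K] {h : K →+* Qpbar p} (hy : IsTranscOver (ι.comp h) y) (S : PadicSetup p) :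
    S.vbar.IsTranscendentalTypeOver h s := by
  intro F
  by_cases hF : F = 0
  · simp [hF]
  obtain ⟨N, hN⟩ := eventually_atTop.1 (hs.eventually_norm_eval₂ hι (hy F hF))
  refine ⟨N, fun m hm n hn => ?_⟩
  rw [S.v_eq_v_iff, hN m hm, hN n hn]

theorem IsApprox.mem_ZplE_iff (hs : IsApprox ι y s) (hι : ∀ x, ‖ι x‖ = ‖x‖)
    (hy : IsTranscOver (ι.comp (qHomQpbar p)) y) (S : PadicSetup p) (φ : RatFunc ℚ) :
    φ ∈ ZplE p S s ↔ ‖φ.eval (ι.comp (qHomQpbar p)) y‖ ≤ 1 := by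
  have h := hs.eventually_norm_ratFunc_eval hι hy φ
  constructor
  · intro hφ
    obtain ⟨n, ⟨-, h1⟩, -, h2⟩ := (hφ.and h).exists
    rwa [S.v_nonneg_iff, h2] at h1
  · intro hφ
    filter_upwards [h] with n hn
    exact ⟨hn.1, by rwa [S.v_nonneg_iff, hn.2]⟩

end Approx

/-! ### Approximating polynomials over `ℚ_p` by polynomials over `ℚ` -/

theorem exists_rat_polynomial_approx {Ω : Type} [NormedField Ω] [IsUltrametricDist Ω]
    {h : ℚ_[p] →+* Ω} (hh : ∀ x, ‖h x‖ = ‖x‖) {k : ℚ →+* Ω} (hk : ∀ q : ℚ, k q = h q)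
    (y : Ω) (f : ℚ_[p][X]) {ε : ℝ} (hε : 0 < ε) :
    ∃ g : ℚ[X], ‖f.eval₂ h y - g.eval₂ k y‖ < ε := by
  induction f using Polynomial.induction_on' with
  | add f₁ f₂ h₁ h₂ =>
    obtain ⟨g₁, h₁⟩ := h₁
    obtain ⟨g₂, h₂⟩ := h₂
    refine ⟨g₁ + g₂, ?_⟩
    rw [eval₂_add, eval₂_add, add_sub_add_comm]
    exact (IsUltrametricDist.norm_add_le_max _ _).trans_lt (max_lt h₁ h₂)
  | monomial n a =>
    have hpos : 0 < ‖y ^ n‖ + 1 := by positivity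
    obtain ⟨q, hq⟩ := Padic.rat_dense p a (div_pos hε hpos)
    refine ⟨monomial n q, ?_⟩
    rw [eval₂_monomial, eval₂_monomial, hk, ← sub_mul, ← map_sub, norm_mul, hh]
    calc ‖a - q‖ * ‖y ^ n‖ ≤ ‖a - q‖ * (‖y ^ n‖ + 1) := by gcongr; linarith
      _ < ε := (lt_div_iff₀ hpos).1 hq

end

section

variable {p}

/-! ### The valuation rings `ℤ_{(p),α}` -/

theorem exists_norm_pow_eq_zpow (F : IntermediateField ℚ_[p] (Qpbar p)) [FiniteDimensional ℚ_[p] F]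
    {a : Qpbar p} (ha : a ∈ F) (ha0 : a ≠ 0) :
    ∃ k : ℤ, ‖a‖ ^ Module.finrank ℚ_[p] F = ‖((p : ℚ_[p]) ^ k)‖ := by
  have hint : IsIntegral ℚ_[p] a := Algebra.IsIntegral.isIntegral a
  have hmin : minpoly ℚ_[p] (⟨a, ha⟩ : F) = minpoly ℚ_[p] a := by
    simpa using (minpoly.algebraMap_eq (A := ℚ_[p]) (B := F) (B' := Qpbar p)
      (algebraMap F (Qpbar p)).injective ⟨a, ha⟩).symm
  obtain ⟨d, hd⟩ := minpoly.degree_dvd (K := ℚ_[p]) (L := F) (x := ⟨a, ha⟩)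
    (Algebra.IsIntegral.isIntegral _)
  rw [hmin] at hd
  have hdeg := minpoly.natDegree_pos hint
  have hc0 : (minpoly ℚ_[p] a).coeff 0 ≠ 0 := minpoly.coeff_zero_ne_zero hint ha0
  have h1 : ‖a‖ ^ (minpoly ℚ_[p] a).natDegree = ‖(minpoly ℚ_[p] a).coeff 0‖ := by
    have := spectralNorm.spectralNorm_eq_norm_coeff_zero_rpow (K := ℚ_[p]) (L := Qpbar p) a
    rw [show ‖a‖ = _ from this, ← Real.rpow_natCast, ← Real.rpow_mul (norm_nonneg _),
      one_div_mul_cancel (by positivity), Real.rpow_one]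
  refine ⟨((minpoly ℚ_[p] a).coeff 0).valuation * d, ?_⟩
  rw [hd, pow_mul, h1, Padic.norm_eq_zpow_neg_valuation hc0, norm_zpow, Padic.norm_p, inv_zpow',
    ← zpow_natCast, ← zpow_mul, neg_mul]

theorem eval₂_mem_adjoin (α : Qpbar p) (f : ℚ[X]) :
    f.eval₂ (qHomQpbar p) α ∈ IntermediateField.adjoin ℚ_[p] {α} := by
  rw [qHomQpbar, ← eval₂_map]
  exact IntermediateField.algebra_adjoin_le_adjoin ℚ_[p] {α} (aeval_mem_adjoin_singleton ℚ_[p] α)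

theorem ratFunc_eval_mem_adjoin (α : Qpbar p) (φ : RatFunc ℚ) :
    φ.eval (qHomQpbar p) α ∈ IntermediateField.adjoin ℚ_[p] {α} :=
  div_mem (eval₂_mem_adjoin α _) (eval₂_mem_adjoin α _)

theorem mem_ZplaBar_iff (S : PadicSetup p) {α : Qpbar p} (hα : IsTranscOver (qHomQpbar p) α)
    (φ : RatFunc ℚ) : φ ∈ ZplaBar p S α ↔ ‖φ.eval (qHomQpbar p) α‖ ≤ 1 := by
  rw [← S.v_nonneg_iff]
  exact and_iff_right (hα _ φ.denom_ne_zero)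

theorem isFiniteExt_of_mem_iff {W : ValuationSubring (RatFunc ℚ)} {α : Qpbar p}
    (hα : IsTranscOver (qHomQpbar p) α) (hW : ∀ φ, φ ∈ W ↔ ‖φ.eval (qHomQpbar p) α‖ ≤ 1) :
    (∃ N : ℕ, 0 < N ∧ ∀ φ : RatFunc ℚ, φ ≠ 0 → ∃ c : ℚ, c ≠ 0 ∧
        φ ^ N / RatFunc.C c ∈ W ∧ RatFunc.C c / φ ^ N ∈ W) ∧
      Finite (IsLocalRing.ResidueField W) := by
  let F := IntermediateField.adjoin ℚ_[p] {α}
  have hfin : FiniteDimensional ℚ_[p] F :=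
    IntermediateField.adjoin.finiteDimensional (Algebra.IsIntegral.isIntegral α)
  let j := ratFuncEvalHom (qHomQpbar p) α hα
  have hj : ∀ φ, φ ∈ W ↔ ‖j φ‖ ≤ 1 := hW
  have hjF : ∀ φ, j φ ∈ F := ratFunc_eval_mem_adjoin α
  refine ⟨⟨Module.finrank ℚ_[p] F, Module.finrank_pos, fun φ hφ => ?_⟩, ?_⟩
  · obtain ⟨k, hk⟩ := exists_norm_pow_eq_zpow F (hjF φ) (by simpa using hφ)
    have hp0 : (p : ℚ) ≠ 0 := by exact_mod_cast (Fact.out : p.Prime).ne_zero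
    have hjC : ‖j (RatFunc.C ((p : ℚ) ^ k))‖ = ‖((p : ℚ_[p]) ^ k)‖ := by
      rw [show j (RatFunc.C ((p : ℚ) ^ k)) = qHomQpbar p ((p : ℚ) ^ k) from
        RatFunc.eval_C _ _, norm_qHomQpbar]
      push_cast
      rfl
    have hpos : ‖((p : ℚ_[p]) ^ k)‖ ≠ 0 := by
      rw [norm_ne_zero_iff]
      exact zpow_ne_zero _ (by exact_mod_cast (Fact.out : p.Prime).ne_zero)
    refine ⟨(p : ℚ) ^ k, zpow_ne_zero _ hp0, ?_, ?_⟩ <;>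
      rw [hj, map_div₀, norm_div, map_pow, norm_pow, hk, hjC, div_self hpos]
  · have : ProperSpace F := FiniteDimensional.proper ℚ_[p] F
    obtain ⟨T, hT, hcov⟩ := Metric.totallyBounded_iff.1
      (isCompact_closedBall (0 : F) 1).totallyBounded 1 one_pos
    obtain ⟨r, hr⟩ := (IsLocalRing.residue_surjective (R := W)).hasRightInverse
    have hex : ∀ κ, ∃ t : T, ‖j (r κ) - ((t : F) : Qpbar p)‖ < 1 := by
      intro κ
      have hmem : (⟨j (r κ), hjF _⟩ : F) ∈ Metric.closedBall (0 : F) 1 := by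
        rw [mem_closedBall_zero_iff]
        exact (hj _).1 (r κ).2
      have h1 := hcov hmem
      simp only [Set.mem_iUnion, Metric.mem_ball, dist_eq_norm] at h1
      obtain ⟨t, ht, h1⟩ := h1
      exact ⟨⟨t, ht⟩, h1⟩
    choose t ht using hex
    have := hT.to_subtype
    refine Finite.of_injective t fun κ κ' h => ?_
    rw [← sub_eq_zero, ← hr κ, ← hr κ', ← map_sub, residue_eq_zero_iff_norm_lt_one hj]
    have h1 := ht κ'
    rw [← h] at h1
    push_cast
    rw [map_sub, show j (r κ) - j (r κ') =
      (j (r κ) - ((t κ : F) : Qpbar p)) - (j (r κ') - ((t κ : F) : Qpbar p)) by ring]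
    exact (norm_sub_le_max _ _).trans_lt (max_lt (ht κ) h1)

theorem exists_ratFunc_norm_eval_sub_lt {α a : Qpbar p}
    (ha : a ∈ IntermediateField.adjoin ℚ_[p] {α}) {ε : ℝ} (hε : 0 < ε) :
    ∃ φ : RatFunc ℚ, ‖φ.eval (qHomQpbar p) α - a‖ < ε := by
  rw [← IntermediateField.mem_toSubalgebra, IntermediateField.adjoin_simple_toSubalgebra_of_isAlgebraic
    (Algebra.IsAlgebraic.isAlgebraic α), Algebra.adjoin_singleton_eq_range_aeval] at ha
  obtain ⟨f, rfl⟩ := ha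
  obtain ⟨g, hg⟩ := exists_rat_polynomial_approx (h := algebraMap ℚ_[p] (Qpbar p))
    (PadicAlgCl.norm_extends p) (k := qHomQpbar p) (fun q => rfl) α f hε
  refine ⟨algebraMap ℚ[X] (RatFunc ℚ) g, ?_⟩
  rw [RatFunc.eval_algebraMap, norm_sub_rev]
  exact hg

theorem valSet_eq_valSetElem (S : PadicSetup p) (α : Qpbar p) :
    {γ : ℚ | ∃ φ : RatFunc ℚ, S.vbar.v (φ.eval (qHomQpbar p) α) = (γ : WithTop ℚ)} =
      valSetElem p S α := by
  ext γ
  constructor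
  · rintro ⟨φ, hφ⟩
    exact ⟨_, ratFunc_eval_mem_adjoin α φ, hφ⟩
  · rintro ⟨a, ha, haγ⟩
    have ha0 : a ≠ 0 := by
      rw [Ne, ← S.vbar.v_eq_top_iff, haγ]
      exact WithTop.coe_ne_top
    obtain ⟨φ, hφ⟩ := exists_ratFunc_norm_eval_sub_lt ha (norm_pos_iff.2 ha0)
    refine ⟨φ, ?_⟩
    rw [← haγ, S.v_eq_v_iff]
    have := norm_sub_eq_of_norm_lt ((norm_sub_rev _ _).trans_lt hφ)
    rwa [sub_sub_cancel] at this

theorem exists_mem_ZplaBar_sub (S : PadicSetup p) {α a : Qpbar p}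
    (hα : IsTranscOver (qHomQpbar p) α) (ha : a ∈ IntermediateField.adjoin ℚ_[p] {α})
    (ha0 : 0 ≤ S.vbar.v a) :
    ∃ φ ∈ ZplaBar p S α, 0 < S.vbar.v (φ.eval (qHomQpbar p) α - a) := by
  obtain ⟨φ, hφ⟩ := exists_ratFunc_norm_eval_sub_lt ha one_pos
  refine ⟨φ, ?_, S.v_pos_iff.2 hφ⟩
  rw [mem_ZplaBar_iff S hα, ← sub_add_cancel (φ.eval (qHomQpbar p) α) a]
  exact (IsUltrametricDist.norm_add_le_max _ _).trans (max_le hφ.le (S.v_nonneg_iff.1 ha0))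

/-! ### Immediacy of `ℤ_{(p),E} ⊆ ℤ_{p,E}` -/

theorem IsTranscOver.of_padic {F : Type} [Field F] {ι : Qpbar p →+* F} {y : F}
    (hy : IsTranscOver (ι.comp (algebraMap ℚ_[p] (Qpbar p))) y) :
    IsTranscOver (ι.comp (qHomQpbar p)) y := by
  intro f hf
  have := hy (f.map (Rat.castHom ℚ_[p])) (by simpa using hf)
  rwa [eval₂_map] at this

section Immediate

variable {Ω : Type} [NormedField Ω] [IsUltrametricDist Ω] {ι : Qpbar p →+* Ω} {y : Ω}

theorem exists_rat_polynomial_norm_eq (hι : ∀ x, ‖ι x‖ = ‖x‖)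
    (hy : IsTranscOver (ι.comp (algebraMap ℚ_[p] (Qpbar p))) y) {f : ℚ_[p][X]} (hf : f ≠ 0)
    {ε : ℝ} (hε : 0 < ε) :
    ∃ g : ℚ[X], g ≠ 0 ∧
      ‖f.eval₂ (ι.comp (algebraMap ℚ_[p] (Qpbar p))) y - g.eval₂ (ι.comp (qHomQpbar p)) y‖ < ε ∧
      ‖g.eval₂ (ι.comp (qHomQpbar p)) y‖ = ‖f.eval₂ (ι.comp (algebraMap ℚ_[p] (Qpbar p))) y‖ := by
  have hfy := norm_pos_iff.2 (hy f hf)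
  obtain ⟨g, hg⟩ := exists_rat_polynomial_approx (h := ι.comp (algebraMap ℚ_[p] (Qpbar p)))
    (fun x => (hι _).trans (PadicAlgCl.norm_extends p x)) (k := ι.comp (qHomQpbar p))
    (fun q => rfl) y f (lt_min hε hfy)
  have h1 := norm_sub_eq_of_norm_lt (hg.trans_le (min_le_right _ _))
  rw [sub_sub_cancel] at h1
  refine ⟨g, ?_, hg.trans_le (min_le_left _ _), h1⟩
  rintro rfl
  rw [eval₂_zero, norm_zero] at h1
  exact hfy.ne h1

theorem IsApprox.exists_ratFunc_v_eq {s : ℕ → Qpbar p} (hs : IsApprox ι y s)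
    (hι : ∀ x, ‖ι x‖ = ‖x‖) (hy : IsTranscOver (ι.comp (algebraMap ℚ_[p] (Qpbar p))) y)
    (S : PadicSetup p) {φ : RatFunc ℚ_[p]} (hφ : φ ≠ 0) :
    ∃ ψ : RatFunc ℚ, ψ ≠ 0 ∧ ∀ᶠ n in atTop,
      S.vbar.v (φ.eval (algebraMap ℚ_[p] (Qpbar p)) (s n)) =
        S.vbar.v (ψ.eval (qHomQpbar p) (s n)) := by
  obtain ⟨f, hf0, -, hf⟩ := exists_rat_polynomial_norm_eq hι hy (RatFunc.num_ne_zero hφ) one_pos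
  obtain ⟨g, hg0, -, hg⟩ := exists_rat_polynomial_norm_eq hι hy φ.denom_ne_zero one_pos
  refine ⟨algebraMap ℚ[X] (RatFunc ℚ) f / algebraMap ℚ[X] (RatFunc ℚ) g,
    div_ne_zero (by simpa using hf0) (by simpa using hg0), ?_⟩
  have hyq := IsTranscOver.of_padic hy
  filter_upwards [hs.eventually_norm_ratFunc_eval hι hy φ, hs.eventually_norm_ratFunc_eval hι hyq
    (algebraMap ℚ[X] (RatFunc ℚ) f / algebraMap ℚ[X] (RatFunc ℚ) g)] with n h1 h2
  rw [S.v_eq_v_iff, h1.2, h2.2, (ratFunc_eval_div _ _ f g (hyq g hg0)).2, RatFunc.eval, norm_div,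
    norm_div, hf, hg]

theorem IsApprox.exists_ratFunc_sub {s : ℕ → Qpbar p} (hs : IsApprox ι y s)
    (hι : ∀ x, ‖ι x‖ = ‖x‖) (hy : IsTranscOver (ι.comp (algebraMap ℚ_[p] (Qpbar p))) y)
    (S : PadicSetup p) {φ : RatFunc ℚ_[p]} (hφ : φ ∈ ZpE p S s) :
    ∃ ψ ∈ ZplE p S s, ∀ᶠ n in atTop,
      0 < S.vbar.v (φ.eval (algebraMap ℚ_[p] (Qpbar p)) (s n) - ψ.eval (qHomQpbar p) (s n)) := by
  by_cases hφ0 : φ = 0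
  · subst hφ0
    have h0 : S.vbar.v 0 = ⊤ := (S.vbar.v_eq_top_iff 0).2 rfl
    exact ⟨0, by simp [ZplE, h0], by simp [h0]⟩
  have hyq := IsTranscOver.of_padic hy
  have hdy := norm_pos_iff.2 (hy _ φ.denom_ne_zero)
  obtain ⟨f, hf0, hfε, hf⟩ := exists_rat_polynomial_norm_eq hι hy (RatFunc.num_ne_zero hφ0) hdy
  obtain ⟨g, hg0, hgε, hg⟩ := exists_rat_polynomial_norm_eq hι hy φ.denom_ne_zero hdy
  have hψ := ratFunc_eval_div (ι.comp (qHomQpbar p)) y f g (hyq g hg0)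
  have hφy : ‖φ.num.eval₂ (ι.comp (algebraMap ℚ_[p] (Qpbar p))) y‖ ≤
      ‖φ.denom.eval₂ (ι.comp (algebraMap ℚ_[p] (Qpbar p))) y‖ := by
    obtain ⟨n, ⟨-, h1⟩, -, h2⟩ := (hφ.and (hs.eventually_norm_ratFunc_eval hι hy φ)).exists
    rwa [S.v_nonneg_iff, h2, RatFunc.eval, norm_div, div_le_one hdy] at h1
  refine ⟨algebraMap ℚ[X] (RatFunc ℚ) f / algebraMap ℚ[X] (RatFunc ℚ) g, ?_, ?_⟩
  · rw [hs.mem_ZplE_iff hι hyq, hψ.2, norm_div, hf, hg]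
    exact div_le_one_of_le₀ hφy (norm_nonneg _)
  set D : ℚ_[p][X] := φ.num * g.map (Rat.castHom ℚ_[p]) - f.map (Rat.castHom ℚ_[p]) * φ.denom
    with hD
  have hDy : ‖D.eval₂ (ι.comp (algebraMap ℚ_[p] (Qpbar p))) y‖ <
      ‖φ.denom.eval₂ (ι.comp (algebraMap ℚ_[p] (Qpbar p))) y‖ *
        ‖φ.denom.eval₂ (ι.comp (algebraMap ℚ_[p] (Qpbar p))) y‖ := by
    have hcomp : (ι.comp (algebraMap ℚ_[p] (Qpbar p))).comp (Rat.castHom ℚ_[p]) =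
        ι.comp (qHomQpbar p) := rfl
    rw [hD, eval₂_sub, eval₂_mul, eval₂_mul, eval₂_map, eval₂_map, hcomp]
    set a := φ.num.eval₂ (ι.comp (algebraMap ℚ_[p] (Qpbar p))) y
    set b := φ.denom.eval₂ (ι.comp (algebraMap ℚ_[p] (Qpbar p))) y
    set a' := f.eval₂ (ι.comp (qHomQpbar p)) y
    set b' := g.eval₂ (ι.comp (qHomQpbar p)) y
    rw [show a * b' - a' * b = (a - a') * b - a * (b - b') by ring]
    refine (norm_sub_le_max _ _).trans_lt (max_lt ?_ ?_) <;> rw [norm_mul]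
    · exact mul_lt_mul_of_pos_right hfε hdy
    · exact mul_lt_mul_of_le_of_lt_of_nonneg_of_pos hφy hgε (norm_nonneg _) hdy
  have hDs : ∀ᶠ n in atTop, ‖D.eval₂ (algebraMap ℚ_[p] (Qpbar p)) (s n)‖ =
      ‖D.eval₂ (ι.comp (algebraMap ℚ_[p] (Qpbar p))) y‖ := by
    by_cases hD0 : D = 0
    · simp [hD0]
    · exact hs.eventually_norm_eval₂ hι (hy D hD0)
  filter_upwards [hDs, hs.eventually_norm_eval₂ hι (hy _ φ.denom_ne_zero),
    hs.eventually_norm_eval₂ hι (hyq g hg0)] with n h1 h2 h3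
  have hd0 : φ.denom.eval₂ (algebraMap ℚ_[p] (Qpbar p)) (s n) ≠ 0 := by
    rw [← norm_pos_iff, h2]
    exact hdy
  have hgn0 : g.eval₂ (qHomQpbar p) (s n) ≠ 0 := by
    rw [← norm_pos_iff, h3, hg]
    exact hdy
  have hDn : D.eval₂ (algebraMap ℚ_[p] (Qpbar p)) (s n) =
      φ.num.eval₂ (algebraMap ℚ_[p] (Qpbar p)) (s n) * g.eval₂ (qHomQpbar p) (s n) -
        φ.denom.eval₂ (algebraMap ℚ_[p] (Qpbar p)) (s n) * f.eval₂ (qHomQpbar p) (s n) := by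
    rw [hD, eval₂_sub, eval₂_mul, eval₂_mul, eval₂_map, eval₂_map, ← qHomQpbar, mul_comm (f.eval₂ _ _)]
  rw [S.v_pos_iff, (ratFunc_eval_div _ _ f g hgn0).2, RatFunc.eval, div_sub_div _ _ hd0 hgn0,
    ← hDn, norm_div, norm_mul, h1, h2, h3, hg, div_lt_one (mul_pos hdy hdy)]
  exact hDy

end Immediate

end

/-- Let `W` be a residually algebraic torsion extension of `ℤ_(p)` to
`ℚ(X)`, with ramification index `e` and residue degree `f` over `ℤ_(p)`.  Then:
(a) `W = ℤ_{(p),E}` for some pseudo-convergent sequence `E ⊆ Q̄_p` of transcendental type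
over `ℚ`;
(b) the following are equivalent: (1) the completion of `ℚ(X)` with respect to the `W`-adic
topology is a finite extension of `ℚ_p` (equivalently, `(ℚ(X), W)` embeds as a valued field
over `ℚ` into `Q̄_p`); (2) `W = ℤ_{(p),α}` for some `α ∈ Q̄_p` transcendental over `ℚ`;
(3) `e·f < ∞`; and when these hold, the value group of `W` equals `Γ_α` and the residue
field of `W` equals `k_α`;
(c) if `e·f = ∞`, then `E` may be chosen of transcendental type over `ℚ_p`, and the
extension `ℤ_{(p),E} ⊆ ℤ_{p,E}` is immediate (same value group and same residue field). -/
theorem stmt_14 (p : ℕ) [Fact p.Prime] (S : PadicSetup p)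
    (W : ValuationSubring (RatFunc ℚ)) (hW : IsResAlgTorsionQ p W) :
    -- (a)
    (∃ s : ℕ → Qpbar p, S.vbar.IsPseudoConvergent s ∧
      S.vbar.IsTranscendentalTypeOver (qHomQpbar p) s ∧
      (W : Set (RatFunc ℚ)) = ZplE p S s) ∧
    -- (b): (1) ↔ (2)
    ((∃ j : RatFunc ℚ →+* Qpbar p,
        (∀ c : ℚ, j (RatFunc.C c) = qHomQpbar p c) ∧
        (∀ φ : RatFunc ℚ, φ ∈ W ↔ 0 ≤ S.vbar.v (j φ))) ↔
      (∃ α : Qpbar p, IsTranscOver (qHomQpbar p) α ∧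
        (W : Set (RatFunc ℚ)) = ZplaBar p S α)) ∧
    -- (b): (2) ↔ (3)
    ((∃ α : Qpbar p, IsTranscOver (qHomQpbar p) α ∧
        (W : Set (RatFunc ℚ)) = ZplaBar p S α) ↔
      ((∃ N : ℕ, 0 < N ∧ ∀ φ : RatFunc ℚ, φ ≠ 0 → ∃ c : ℚ, c ≠ 0 ∧
          φ ^ N / RatFunc.C c ∈ W ∧ RatFunc.C c / φ ^ N ∈ W) ∧
        Finite (IsLocalRing.ResidueField W))) ∧
    -- (b): in which case `Γ_w = Γ_α` and `k_w = k_α`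
    (∀ α : Qpbar p, IsTranscOver (qHomQpbar p) α →
      (W : Set (RatFunc ℚ)) = ZplaBar p S α →
      ({γ : ℚ | ∃ φ : RatFunc ℚ, S.vbar.v (φ.eval (qHomQpbar p) α) = (γ : WithTop ℚ)}
          = valSetElem p S α) ∧
      (∀ a ∈ IntermediateField.adjoin ℚ_[p] {α}, 0 ≤ S.vbar.v a →
        ∃ φ ∈ ZplaBar p S α, 0 < S.vbar.v (φ.eval (qHomQpbar p) α - a))) ∧
    -- (c)
    (¬ ((∃ N : ℕ, 0 < N ∧ ∀ φ : RatFunc ℚ, φ ≠ 0 → ∃ c : ℚ, c ≠ 0 ∧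
          φ ^ N / RatFunc.C c ∈ W ∧ RatFunc.C c / φ ^ N ∈ W) ∧
        Finite (IsLocalRing.ResidueField W)) →
      ∃ s : ℕ → Qpbar p, S.vbar.IsPseudoConvergent s ∧
        S.vbar.IsTranscendentalTypeOver (algebraMap ℚ_[p] (Qpbar p)) s ∧
        (W : Set (RatFunc ℚ)) = ZplE p S s ∧
        -- the extension `ℤ_{(p),E} ⊆ ℤ_{p,E}` is immediate: same value group …
        (∀ φ : RatFunc ℚ_[p], φ ≠ 0 → ∃ ψ : RatFunc ℚ, ψ ≠ 0 ∧
          ∀ᶠ n in atTop,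
            S.vbar.v (φ.eval (algebraMap ℚ_[p] (Qpbar p)) (s n)) =
              S.vbar.v (ψ.eval (qHomQpbar p) (s n))) ∧
        -- … and same residue field
        (∀ φ ∈ ZpE p S s, ∃ ψ ∈ ZplE p S s,
          ∀ᶠ n in atTop,
            0 < S.vbar.v (φ.eval (algebraMap ℚ_[p] (Qpbar p)) (s n) -
              ψ.eval (qHomQpbar p) (s n)))) := by
  obtain ⟨Ω, _, _, ι, j, hι, hjW, himm, h3X⟩ := hW.exists_ambient
  obtain ⟨s, hs⟩ := exists_isApprox hι himm (j RatFunc.X)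
  have hjC : j.comp RatFunc.C = ι.comp (qHomQpbar p) := Subsingleton.elim _ _
  have hjφ : ∀ φ, j φ = φ.eval (ι.comp (qHomQpbar p)) (j RatFunc.X) := fun φ =>
    hjC ▸ map_eq_ratFunc_eval j φ
  have hX : IsTranscOver (ι.comp (qHomQpbar p)) (j RatFunc.X) := hjC ▸ isTranscOver_map_X j
  have hWE : (W : Set (RatFunc ℚ)) = ZplE p S s := by
    ext φ
    rw [hs.mem_ZplE_iff hι hX, ← hjφ]
    exact hjW φ
  have hWα : ∀ α, IsTranscOver (qHomQpbar p) α → ((W : Set (RatFunc ℚ)) = ZplaBar p S α ↔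
      ∀ φ, φ ∈ W ↔ ‖φ.eval (qHomQpbar p) α‖ ≤ 1) := fun α hα => by
    simp_rw [Set.ext_iff, mem_ZplaBar_iff S hα, SetLike.mem_coe]
  have hrange : j RatFunc.X ∈ Set.range ι → ∃ α : Qpbar p, IsTranscOver (qHomQpbar p) α ∧
      (W : Set (RatFunc ℚ)) = ZplaBar p S α := by
    rintro ⟨α, hα⟩
    have htr : IsTranscOver (qHomQpbar p) α := by
      intro f hf h0
      apply hX f hf
      rw [← hα, ← hom_eval₂, h0, map_zero]
    refine ⟨α, htr, (hWα α htr).2 fun φ => ?_⟩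
    rw [hjW, hjφ, ← hα, ← map_ratFunc_eval, hι]
  refine ⟨⟨s, hs.isPseudoConvergent hι S, hs.isTranscendentalTypeOver hι hX S, hWE⟩,
    ⟨?_, ?_⟩, ⟨?_, fun h3 => hrange (h3X h3)⟩, fun α hα _ => ⟨valSet_eq_valSetElem S α,
      fun a ha ha0 => exists_mem_ZplaBar_sub S hα ha ha0⟩, fun h3 => ?_⟩
  · rintro ⟨k, hk, hkW⟩
    have hkC : k.comp RatFunc.C = qHomQpbar p := RingHom.ext hk
    have htr : IsTranscOver (qHomQpbar p) (k RatFunc.X) := hkC ▸ isTranscOver_map_X k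
    refine ⟨k RatFunc.X, htr, (hWα _ htr).2 fun φ => ?_⟩
    rw [hkW, S.v_nonneg_iff, map_eq_ratFunc_eval k, hkC]
  · rintro ⟨α, hα, hW'⟩
    refine ⟨ratFuncEvalHom (qHomQpbar p) α hα, fun c => RatFunc.eval_C _ _, fun φ => ?_⟩
    rw [S.v_nonneg_iff]
    exact (hWα α hα).1 hW' φ
  · rintro ⟨α, hα, hW'⟩
    exact isFiniteExt_of_mem_iff hα ((hWα α hα).1 hW')
  · have hy : IsTranscOver (ι.comp (algebraMap ℚ_[p] (Qpbar p))) (j RatFunc.X) := by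
      intro f hf h0
      rw [← eval₂_map, eval₂_eq_prod_roots, mul_eq_zero, Multiset.prod_eq_zero_iff,
        Multiset.mem_map] at h0
      rcases h0 with h0 | ⟨a, -, ha⟩
      · simp [hf] at h0
      · obtain ⟨α, hα, hW'⟩ := hrange ⟨a, (sub_eq_zero.1 ha).symm⟩
        exact h3 (isFiniteExt_of_mem_iff hα ((hWα α hα).1 hW'))
    exact ⟨s, hs.isPseudoConvergent hι S, hs.isTranscendentalTypeOver hι hy S, hWE,
      fun φ hφ => hs.exists_ratFunc_v_eq hι hy S hφ,
      fun φ hφ => hs.exists_ratFunc_sub hι hy S hφ⟩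

end
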